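/- Let $A_\Gamma$ be an Artin group of large type (all labels $m(x,y) \geq 3$, possibly $\infty$) and let $a, b, c \in X$ be pairwise distinct generators. Then for any signs $\varepsilon_1, \varepsilon_2, \varepsilon_3 \in \{1,-1\}$, the pair $(a^{\varepsilon_1} b^{\varepsilon_2},\; c^{\varepsilon_3})$ is a blocking pair: for every word $w$ over $X$ such that $w a^{\varepsilon_1} b^{\varepsilon_2}$ is geodesic, the word $w a^{\varepsilon_1} b^{\varepsilon_2} c^{\varepsilon_3}$ is also geodesic. -/

import Mathlib

/-- The alternating product `x y x y ⋯` of length `n` in the free group, starting with `x`. -/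
def altProd {X : Type*} : ℕ → X → X → FreeGroup X
  | 0, _, _ => 1
  | n + 1, x, y => FreeGroup.of x * altProd n y x

/-- The Artin relations associated to a labelling `m : X → X → ℕ∞` (label `⊤` = no relation):
for each pair `x ≠ y` with finite label `k`, the relator `(xyx⋯)(yxy⋯)⁻¹` (both of length `k`). -/
def artinRels {X : Type*} (m : X → X → ℕ∞) : Set (FreeGroup X) :=
  { r | ∃ (x y : X) (k : ℕ), x ≠ y ∧ m x y = (k : ℕ∞) ∧
      r = altProd k x y * (altProd k y x)⁻¹ }

/-- The Artin group of the labelled graph encoded by `m`. -/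
abbrev ArtinGroup {X : Type*} (m : X → X → ℕ∞) : Type _ := PresentedGroup (artinRels m)

/-- The standard generators of the Artin group. -/
def artinGen {X : Type*} (m : X → X → ℕ∞) (x : X) : ArtinGroup m := PresentedGroup.of x

/-- The Artin monoid: the submonoid of the Artin group generated by the standard generators. -/
def artinMonoid {X : Type*} (m : X → X → ℕ∞) : Submonoid (ArtinGroup m) :=
  Submonoid.closure (Set.range (artinGen m))

/-- The monoid word metric on a group `G` relative to a submonoid `M`: `monoidDist M g h` is the
least `n` such that `g⁻¹ * h` is a product of `n` elements each lying in `M` or `M⁻¹`. -/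
noncomputable def monoidDist {G : Type*} [Group G] (M : Submonoid G) (g h : G) : ℕ :=
  sInf { n : ℕ | ∃ l : List G, l.length = n ∧ (∀ a ∈ l, a ∈ M ∨ a⁻¹ ∈ M) ∧ g⁻¹ * h = l.prod }

/-- A word over `X`: a list of letters `x^ε`, where `ε = true` denotes the positive letter `x`
and `ε = false` the negative letter `x⁻¹`. -/
abbrev Word (X : Type*) := List (X × Bool)

/-- The element of `G` represented by a word over `X`, given `f : X → G`. -/
def evalWord {X G : Type*} [Group G] (f : X → G) (w : Word X) : G :=
  (w.map (fun p => if p.2 then f p.1 else (f p.1)⁻¹)).prod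

/-- A word is positive if all its letters are positive. -/
def IsPosWord {X : Type*} (w : Word X) : Prop := ∀ p ∈ w, p.2 = true

/-- A word is negative if all its letters are negative. -/
def IsNegWord {X : Type*} (w : Word X) : Prop := ∀ p ∈ w, p.2 = false

/-- A word is geodesic if no strictly shorter word represents the same element of `G`. -/
def IsGeodesic {X G : Type*} [Group G] (f : X → G) (w : Word X) : Prop :=
  ∀ v : Word X, evalWord f v = evalWord f w → w.length ≤ v.length

/-- `(u, x)` is a blocking pair if for every word `w` such that `w ++ u` is geodesic,
the word `w ++ u ++ [x]` is also geodesic. -/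
def BlockingPair {X G : Type*} [Group G] (f : X → G) (u : Word X) (x : X × Bool) : Prop :=
  ∀ w : Word X, IsGeodesic f (w ++ u) → IsGeodesic f (w ++ u ++ [x])

/-- An alternating blocking sequence `(α n)` (indexed from `n = 1`; the value `α 0` is ignored):
each `α n` is nonempty, positive for odd `n` and negative for even `n`, and every letter `x`
of `α n` is immediately preceded, within `α (n-1) ++ α n` (with `α 0` read as the empty word),
by a subword `u` such that `(u, x)` is a blocking pair. -/
def IsAltBlockingSeq {X G : Type*} [Group G] (f : X → G) (α : ℕ → Word X) : Prop :=
  (∀ n, 1 ≤ n → α n ≠ []) ∧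
  (∀ n, 1 ≤ n → Odd n → IsPosWord (α n)) ∧
  (∀ n, 1 ≤ n → Even n → IsNegWord (α n)) ∧
  (∀ n, 1 ≤ n → ∀ p x s, α n = p ++ x :: s →
    ∃ u : Word X, u <:+ ((if n = 1 then ([] : Word X) else α (n - 1)) ++ p) ∧
      BlockingPair f u x)

/-- `u` is the longest positive (`ε = true`) resp. negative (`ε = false`) proper suffix of `w`. -/
def IsLongestSignedProperSuffix {X : Type*} (ε : Bool) (w u : Word X) : Prop :=
  u <:+ w ∧ u ≠ w ∧ (∀ p ∈ u, p.2 = ε) ∧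
    ∀ v : Word X, v <:+ w → v ≠ w → (∀ p ∈ v, p.2 = ε) → v.length ≤ u.length

/-- Preserved positive (`ε = true`) resp. negative (`ε = false`) suffixes: whenever `w` is a
geodesic word ending in a letter of sign `ε`, `u` is the longest proper suffix of `w` of sign `ε`,
and `a` is a generator, the element represented by `a^ε · w` admits a geodesic representative
having `u` as a suffix. -/
def PreservedSignSuffixes {X G : Type*} [Group G] (ε : Bool) (f : X → G) : Prop :=
  ∀ (w : Word X) (y : X), IsGeodesic f w → w.getLast? = some (y, ε) →
    ∀ u : Word X, IsLongestSignedProperSuffix ε w u →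
    ∀ a : X, ∃ w' : Word X, IsGeodesic f w' ∧
      evalWord f w' = evalWord f ((a, ε) :: w) ∧ u <:+ w'

/-- Preserved signed suffixes: both preserved positive and preserved negative suffixes. -/
def PreservedSignedSuffixes {X G : Type*} [Group G] (f : X → G) : Prop :=
  PreservedSignSuffixes true f ∧ PreservedSignSuffixes false f

/-! ### Words and dihedral systems -/

/-- The formal inverse of a letter. -/
def letterInv {X : Type*} (s : X × Bool) : X × Bool := (s.1, !s.2)

@[simp] theorem letterInv_fst {X : Type*} (s : X × Bool) : (letterInv s).1 = s.1 := rfl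

@[simp] theorem letterInv_letterInv {X : Type*} (s : X × Bool) :
    letterInv (letterInv s) = s := by
  simp [letterInv]

theorem eq_or_eq_letterInv {X : Type*} {s t : X × Bool} (h : s.1 = t.1) :
    s = t ∨ t = letterInv s := by
  obtain ⟨x, a⟩ := s
  obtain ⟨y, b⟩ := t
  obtain rfl : x = y := h
  cases a <;> cases b <;> simp [letterInv]

/-- All letters of the word `u` are powers of `x` or `y`. -/
def OnPair {X : Type*} (x y : X) (u : Word X) : Prop := ∀ p ∈ u, p.1 = x ∨ p.1 = y

section OnPair

variable {X : Type*} {x y : X} {u v : Word X} {s : X × Bool}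

@[simp] theorem onPair_nil : OnPair x y ([] : Word X) := by simp [OnPair]

@[simp] theorem onPair_cons : OnPair x y (s :: u) ↔ (s.1 = x ∨ s.1 = y) ∧ OnPair x y u := by
  simp [OnPair]

@[simp] theorem onPair_append : OnPair x y (u ++ v) ↔ OnPair x y u ∧ OnPair x y v := by
  simp only [OnPair, List.mem_append, or_imp, forall_and]

theorem OnPair.swap (h : OnPair x y u) : OnPair y x u := fun p hp => (h p hp).symm

theorem OnPair.left (h : OnPair x x u) : OnPair x y u := fun p hp => Or.inl (by simpa using h p hp)

theorem OnPair.right (h : OnPair y y u) : OnPair x y u := fun p hp => Or.inr (by simpa using h p hp)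

end OnPair

/-- A word over `x, y` is `E`-geodesic if it is not longer than any equivalent word over `x, y`. -/
def PairGeod {X : Type*} (E : X → X → Word X → Word X → Prop) (x y : X) (u : Word X) : Prop :=
  ∀ v, OnPair x y v → E x y u v → u.length ≤ v.length

/-- The properties of the equality relations `E x y` in the rank two Artin groups on pairs `x, y`
from which geodesics of the ambient group are controlled. -/
structure DihedralSystem {X : Type*} (E : X → X → Word X → Word X → Prop) : Prop where
  refl : ∀ x y u, E x y u u
  symm : ∀ {x y u v}, E x y u v → E x y v u
  trans : ∀ {x y u v w}, E x y u v → E x y v w → E x y u w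
  swap : ∀ {x y u v}, E x y u v → E y x u v
  append_right : ∀ {x y u v} (w), E x y u v → E x y (u ++ w) (v ++ w)
  cons : ∀ {x y u v} (s), E x y u v → E x y (s :: u) (s :: v)
  inv_cons_cons : ∀ {x y u} (s), E x y (letterInv s :: s :: u) u
  exchange : ∀ {x y u s}, x ≠ y → OnPair x y (s :: u) → PairGeod E x y u →
    ¬ PairGeod E x y (s :: u) →
    ∃ q, OnPair x y q ∧ E x y u (letterInv s :: q) ∧ q.length + 1 = u.length
  not_inv : ∀ {x y u v s}, x ≠ y → OnPair x y (s :: u) → OnPair x y v → PairGeod E x y (s :: u) →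
    E x y (s :: u) (letterInv s :: v) → u.length = v.length → False
  two_blocks : ∀ {x y α β u s}, x ≠ y → OnPair x x α → OnPair y y β → α ≠ [] →
    PairGeod E x y (α ++ β) → s.1 = y → OnPair x y u → E x y (α ++ β) (s :: u) →
    α.length + β.length = u.length + 1 → False

/-- Length preserving equivalence of words generated by moves inside pairs of generators. -/
inductive WordEquiv {X : Type*} (E : X → X → Word X → Word X → Prop) : Word X → Word X → Prop
  | nil : WordEquiv E [] []
  | cons (s : X × Bool) {w w' : Word X} : WordEquiv E w w' → WordEquiv E (s :: w) (s :: w')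
  | move {s t : X × Bool} {u v z w w' : Word X} : s.1 ≠ t.1 → OnPair s.1 t.1 u → OnPair s.1 t.1 v →
      E s.1 t.1 (s :: u) (t :: v) → u.length = v.length →
      WordEquiv E w (u ++ z) → WordEquiv E w' (v ++ z) → WordEquiv E (s :: w) (t :: w')

/-- A word is reduced if no suffix is equivalent to one starting with the inverse of the letter
preceding it. -/
def IsRed {X : Type*} (E : X → X → Word X → Word X → Prop) : Word X → Prop
  | [] => True
  | s :: w => IsRed E w ∧ ∀ w', ¬ WordEquiv E w (letterInv s :: w')

/-- The word `w` is equivalent to one starting with a power of `x`. -/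
def HasDesc {X : Type*} (E : X → X → Word X → Word X → Prop) (w : Word X) (x : X) : Prop :=
  ∃ (s : X × Bool) (w' : Word X), s.1 = x ∧ WordEquiv E w (s :: w')

/-- Reduced words of length `n` form a union of equivalence classes. -/
def EquivUpTo {X : Type*} (E : X → X → Word X → Word X → Prop) (n : ℕ) : Prop :=
  ∀ w, IsRed E w → w.length ≤ n → ∀ w', WordEquiv E w w' →
    IsRed E w' ∧ ∀ w'', WordEquiv E w' w'' → WordEquiv E w w''

namespace WordEquiv

variable {X : Type*} {E : X → X → Word X → Word X → Prop} {w w' : Word X}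

theorem refl : ∀ w : Word X, WordEquiv E w w
  | [] => .nil
  | s :: w => .cons s (refl w)

theorem symm (hE : DihedralSystem E) (h : WordEquiv E w w') : WordEquiv E w' w := by
  induction h with
  | nil => exact .nil
  | cons s _ ih => exact .cons s ih
  | move hst hu hv he hl h1 h2 _ _ =>
    exact .move hst.symm hv.swap hu.swap (hE.swap (hE.symm he)) hl.symm h2 h1

theorem length_eq (h : WordEquiv E w w') : w.length = w'.length := by
  induction h with
  | nil => rfl
  | cons s _ ih => simp [ih]
  | move _ _ _ _ hl _ _ ih1 ih2 => simp_all

theorem append_left (h : WordEquiv E w w') : ∀ u : Word X, WordEquiv E (u ++ w) (u ++ w')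
  | [] => h
  | s :: u => .cons s (append_left h u)

end WordEquiv

namespace DihedralSystem

variable {X : Type*} {E : X → X → Word X → Word X → Prop} {x y : X} {s t r : X × Bool}
  {u v w w' z z' h h' : Word X} {N : ℕ}

theorem cancel (hE : DihedralSystem E) (h : E x y (s :: u) (s :: v)) : E x y u v :=
  hE.trans (hE.symm (hE.inv_cons_cons s)) (hE.trans (hE.cons (letterInv s) h) (hE.inv_cons_cons s))

theorem cons_of_inv (hE : DihedralSystem E) (h : E x y u (letterInv s :: v)) :
    E x y (s :: u) v := by
  have := hE.trans (hE.cons s h) (by simpa using hE.inv_cons_cons (u := v) (letterInv s))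
  exact this

theorem geod_tail (hE : DihedralSystem E) (hs : s.1 = x ∨ s.1 = y) (h : PairGeod E x y (s :: u)) :
    PairGeod E x y u := by
  intro v hv he
  have := h (s :: v) (by simp [hs, hv]) (hE.cons s he)
  simpa using this

theorem geod_congr (hE : DihedralSystem E) (h : PairGeod E x y u) (he : E x y u v)
    (hl : u.length = v.length) : PairGeod E x y v :=
  fun w hw hvw => hl ▸ h w hw (hE.trans he hvw)

theorem isRed_suffix : ∀ u : Word X, IsRed E (u ++ z) → IsRed E z
  | [], h => h
  | _ :: u, h => isRed_suffix u h.1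

/-- Equivalent geodesic prefixes over a pair of generators may be exchanged. -/
theorem wordEquiv_of_geod (hE : DihedralSystem E) (hxy : x ≠ y) : ∀ {u v : Word X},
    OnPair x y u → OnPair x y v → PairGeod E x y u → E x y u v → u.length = v.length →
    WordEquiv E (u ++ z) (v ++ z)
  | [], v, _, _, _, _, hl => by
    obtain rfl : v = [] := by simpa [eq_comm] using hl
    exact .refl _
  | s :: u, [], _, _, _, _, hl => by simp at hl
  | s :: u, t :: v, hu, hv, hg, he, hl => by
    simp only [List.length_cons, add_left_inj] at hl
    rw [onPair_cons] at hv
    by_cases hst : s.1 = t.1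
    · rcases eq_or_eq_letterInv hst with rfl | rfl
      · exact .cons _ (hE.wordEquiv_of_geod hxy (onPair_cons.1 hu).2 hv.2
          (hE.geod_tail hv.1 hg) (hE.cancel he) hl)
      · exact (hE.not_inv hxy hu hv.2 hg he hl).elim
    · rw [onPair_cons] at hu
      have key : (s.1 = x ∧ t.1 = y) ∨ (s.1 = y ∧ t.1 = x) := by
        rcases hu.1 with h1 | h1 <;> rcases hv.1 with h2 | h2 <;> simp_all
      rcases key with ⟨rfl, rfl⟩ | ⟨rfl, rfl⟩
      · exact .move hst hu.2 hv.2 he hl (.refl _) (.refl _)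
      · exact .move hst hu.2.swap hv.2.swap (hE.swap he) hl (.refl _) (.refl _)

theorem geod_of_isRed (hE : DihedralSystem E) (hxy : x ≠ y) : ∀ {u : Word X},
    OnPair x y u → IsRed E (u ++ z) → PairGeod E x y u
  | [], _, _ => fun _ _ _ => by simp
  | s :: u, hu, hr => by
    by_contra hg
    have hgu := hE.geod_of_isRed hxy (onPair_cons.1 hu).2 hr.1
    obtain ⟨q, hq, he, hl⟩ := hE.exchange hxy hu hgu hg
    exact hr.2 (q ++ z) (hE.wordEquiv_of_geod hxy (onPair_cons.1 hu).2 (v := letterInv s :: q)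
      (by simp only [onPair_cons] at hu ⊢; exact ⟨hu.1, hq⟩) hgu he (by simp [hl]))

/-- If `s :: w` is reduced and `w` is equivalent to `u ++ z`, then `s :: u` is geodesic. -/
theorem geod_cons (hE : DihedralSystem E) (hN : EquivUpTo E N) (hxy : x ≠ y)
    (hu : OnPair x y (s :: u)) (hw : IsRed E (s :: w)) (hl : w.length ≤ N)
    (h : WordEquiv E w (u ++ z)) : PairGeod E x y (s :: u) := by
  refine hE.geod_of_isRed hxy (z := z) hu ⟨(hN w hw.1 hl _ h).1, fun w' hw' => ?_⟩
  exact hw.2 w' ((hN w hw.1 hl _ h).2 _ hw')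

theorem exists_decomp (hN : EquivUpTo E N) (x y : X) : ∀ (n : ℕ) (w : Word X), w.length = n →
    n ≤ N → IsRed E w →
    ∃ u z, OnPair x y u ∧ WordEquiv E w (u ++ z) ∧ ¬ HasDesc E z x ∧ ¬ HasDesc E z y := by
  intro n
  induction n with
  | zero =>
    intro w hw _ hr
    obtain rfl := List.length_eq_zero_iff.1 hw
    refine ⟨[], [], by simp, .nil, ?_, ?_⟩ <;>
    · rintro ⟨s, w', -, h⟩
      simpa using h.length_eq
  | succ n ih =>
    intro w hw hn hr
    by_cases hd : HasDesc E w x ∨ HasDesc E w y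
    · obtain ⟨s, w1, hs, h1⟩ : ∃ (s : X × Bool) (w1 : Word X), (s.1 = x ∨ s.1 = y) ∧
          WordEquiv E w (s :: w1) := by
        rcases hd with ⟨s, w1, hs, h1⟩ | ⟨s, w1, hs, h1⟩
        exacts [⟨s, w1, .inl hs, h1⟩, ⟨s, w1, .inr hs, h1⟩]
      have hl := h1.length_eq
      simp only [List.length_cons] at hl
      have h2 := hN w hr (by omega) _ h1
      obtain ⟨u, z, hu, hz, hm⟩ := ih w1 (by omega) (by omega) h2.1.1
      exact ⟨s :: u, z, by simp [hs, hu], h2.2 _ (.cons s hz), hm⟩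
    · rw [not_or] at hd
      exact ⟨[], w, by simp, .refl _, hd⟩

/-- Uniqueness of the decomposition of a reduced word into a part over `x, y` and a minimal
representative of its coset. -/
theorem decomp_unique (hE : DihedralSystem E) (hN : EquivUpTo E N) (hxy : x ≠ y) :
    ∀ (n : ℕ) {u v z z' : Word X}, (u ++ z).length = n → n ≤ N → IsRed E (u ++ z) →
    OnPair x y u → OnPair x y v → ¬ HasDesc E z x ∧ ¬ HasDesc E z y →
    ¬ HasDesc E z' x ∧ ¬ HasDesc E z' y → WordEquiv E (u ++ z) (v ++ z') →
    E x y u v ∧ u.length = v.length ∧ WordEquiv E z z' := by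
  intro n
  induction n using Nat.strong_induction_on with
  | _ n ih =>
  intro u v z z' hn hnN hr hu hv hz hz' h
  rcases u with _ | ⟨s, u⟩
  · rcases v with _ | ⟨t, v⟩
    · exact ⟨hE.refl _ _ _, rfl, h⟩
    · rcases (onPair_cons.1 hv).1 with ht | ht
      · exact (hz.1 ⟨t, v ++ z', ht, h⟩).elim
      · exact (hz.2 ⟨t, v ++ z', ht, h⟩).elim
  · rcases v with _ | ⟨t, v⟩
    · rcases (onPair_cons.1 hu).1 with hs | hs
      · exact (hz'.1 ⟨s, u ++ z, hs, h.symm hE⟩).elim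
      · exact (hz'.2 ⟨s, u ++ z, hs, h.symm hE⟩).elim
    · simp only [List.cons_append, List.length_cons] at hn
      rw [onPair_cons] at hu hv
      rcases h with _ | ⟨_, h⟩ | ⟨hst, ha, hb, he, hl, h1, h2⟩
      · obtain ⟨h1, h2, h3⟩ := ih _ (by omega) rfl (by omega) hr.1 hu.2 hv.2 hz hz' h
        exact ⟨hE.cons s h1, by simp [h2], h3⟩
      · rename_i a b c
        have key : (s.1 = x ∧ t.1 = y) ∨ (s.1 = y ∧ t.1 = x) := by
          rcases hu.1 with h1 | h1 <;> rcases hv.1 with h2 | h2 <;> simp_all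
        have he' : E x y (s :: a) (t :: b) := by
          rcases key with ⟨rfl, rfl⟩ | ⟨rfl, rfl⟩
          exacts [he, hE.swap he]
        have ha' : OnPair x y a := by
          rcases key with ⟨rfl, rfl⟩ | ⟨rfl, rfl⟩
          exacts [ha, ha.swap]
        have hb' : OnPair x y b := by
          rcases key with ⟨rfl, rfl⟩ | ⟨rfl, rfl⟩
          exacts [hb, hb.swap]
        replace h1 : WordEquiv E (u ++ z) (a ++ c) := h1
        replace h2 : WordEquiv E (v ++ z') (b ++ c) := h2
        have hl1 := h1.length_eq
        have hl2 := h2.length_eq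
        simp only [List.length_append] at hl1 hl2 hn
        have hr1 := hN _ hr.1 (by simp; omega) _ h1
        obtain ⟨p, z0, hp, hpz, hm⟩ := exists_decomp hN x y _ c rfl (by omega)
          (isRed_suffix _ hr1.1)
        have e1 : WordEquiv E (u ++ z) ((a ++ p) ++ z0) := by
          rw [List.append_assoc]
          exact hr1.2 _ (hpz.append_left a)
        obtain ⟨g1, g2, g3⟩ := ih _ (by simp; omega) rfl (by simp; omega) hr.1 hu.2
          (by simp [ha', hp]) hz hm e1
        have hr' : IsRed E (t :: (v ++ z')) :=
          (hN _ hr (by simp; omega) _ (.move hst ha hb he hl h1 h2)).1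
        have hr2 := hN _ hr'.1 (by simp; omega) _ h2
        have e2 : WordEquiv E (v ++ z') ((b ++ p) ++ z0) := by
          rw [List.append_assoc]
          exact hr2.2 _ (hpz.append_left b)
        obtain ⟨k1, k2, k3⟩ := ih _ (by simp; omega) rfl (by simp; omega) hr'.1 hv.2
          (by simp [hb', hp]) hz' hm e2
        refine ⟨?_, ?_, ?_⟩
        · exact hE.trans (hE.cons s g1) (hE.trans (hE.append_right p he') (hE.symm (hE.cons t k1)))
        · simp only [List.length_append, List.length_cons] at g2 k2 ⊢
          omega
        · exact (hN _ (isRed_suffix _ hr.1) (by omega) _ g3).2 _ (k3.symm hE)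

/-- Two decompositions of a reduced word over the same pair, compared after splitting off the
minimal coset representatives. -/
theorem decomp_unique' (hE : DihedralSystem E) (hN : EquivUpTo E N) (hxy : x ≠ y)
    (hw : IsRed E w) (hl : w.length ≤ N) (hu : OnPair x y u) (hv : OnPair x y v)
    (hz : ¬ HasDesc E z x ∧ ¬ HasDesc E z y) (hz' : ¬ HasDesc E z' x ∧ ¬ HasDesc E z' y)
    (h1 : WordEquiv E w (u ++ z)) (h2 : WordEquiv E w (v ++ z')) :
    E x y u v ∧ u.length = v.length ∧ WordEquiv E z z' := by
  have hr := hN w hw hl _ h1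
  have hl1 := h1.length_eq
  refine hE.decomp_unique hN hxy _ rfl (by omega) hr.1 hu hv hz hz' ?_
  exact (hN _ hr.1 (by omega) _ (h1.symm hE)).2 _ h2

/-- A geodesic over `x, y` followed by a minimal coset representative is reduced. -/
theorem isRed_append (hE : DihedralSystem E) (hN : EquivUpTo E N) (hxy : x ≠ y)
    (hz : IsRed E z) (hm : ¬ HasDesc E z x ∧ ¬ HasDesc E z y) : ∀ {u : Word X},
    OnPair x y u → PairGeod E x y u → (u ++ z).length ≤ N + 1 → IsRed E (u ++ z)
  | [], _, _, _ => hz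
  | s :: u, hu, hg, hl => by
    rw [onPair_cons] at hu
    simp only [List.cons_append, List.length_cons] at hl
    have hr := hE.isRed_append hN hxy hz hm hu.2 (hE.geod_tail hu.1 hg) (by omega)
    refine ⟨hr, fun w' hw' => ?_⟩
    have hw1 := (hN _ hr (by omega) _ hw').1.1
    have hlw : (u ++ z).length = w'.length + 1 := hw'.length_eq
    obtain ⟨q, z', hq, hqz, hm'⟩ := exists_decomp hN x y _ w' rfl (by omega) hw1
    have e1 : WordEquiv E (u ++ z) ((letterInv s :: q) ++ z') :=
      (hN _ hr (by omega) _ hw').2 _ (.cons _ hqz)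
    obtain ⟨g1, g2, -⟩ := hE.decomp_unique hN hxy _ rfl (by omega) hr hu.2
      (by simp [hu.1, hq]) hm hm' e1
    have := hg q hq (hE.cons_of_inv g1)
    simp only [List.length_cons] at g2 this
    omega

/-- `t :: w'` has another first letter `s`, as witnessed by a move over the pair `t, s`. -/
def MoveDesc (E : X → X → Word X → Word X → Prop) (t : X × Bool) (w' : Word X)
    (s : X × Bool) : Prop :=
  t.1 ≠ s.1 ∧ ∃ u v z : Word X, OnPair t.1 s.1 u ∧ OnPair t.1 s.1 v ∧
    E t.1 s.1 (t :: v) (s :: u) ∧ v.length = u.length ∧ WordEquiv E w' (v ++ z)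

theorem moveDesc_of_wordEquiv (hst : s.1 ≠ t.1) (h : WordEquiv E (s :: w) (t :: w')) :
    MoveDesc E s w t := by
  rcases h with _ | ⟨_, h⟩ | ⟨_, ha, hb, he, hl, h1, h2⟩
  · exact (hst rfl).elim
  · exact ⟨hst, _, _, _, hb, ha, he, hl, h1⟩

theorem MoveDesc.exists_split (hE : DihedralSystem E) (hN : EquivUpTo E N)
    (hK : MoveDesc E t w s) (hw : IsRed E (t :: w)) (hl : w.length ≤ N) {τ σ : Word X}
    (hτ : OnPair t.1 t.1 τ) (hσ : OnPair s.1 s.1 σ) (h1 : WordEquiv E w (τ ++ σ ++ h)) :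
    ∃ p z, p ≠ [] ∧ OnPair t.1 s.1 p ∧ WordEquiv E h (p ++ z) := by
  obtain ⟨hts, u, v, z, hu, hv, he, hlv, hz⟩ := hK
  have hr1 := hN _ hw.1 hl _ h1
  have hrz := hN _ hw.1 hl _ hz
  have hl1 := h1.length_eq
  have hlz := hz.length_eq
  simp only [List.length_append] at hl1 hlz
  obtain ⟨p, z1, hp, hpz, hm⟩ := exists_decomp hN t.1 s.1 _ h rfl (by omega)
    (isRed_suffix _ hr1.1)
  refine ⟨p, z1, ?_, hp, hpz⟩
  rintro rfl
  obtain ⟨a, z0, ha, haz, hm0⟩ := exists_decomp hN t.1 s.1 _ z rfl (by omega)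
    (isRed_suffix _ hrz.1)
  have e1 : WordEquiv E w ((τ ++ σ) ++ z1) := hr1.2 _ (hpz.append_left _)
  have e2 : WordEquiv E w ((v ++ a) ++ z0) := by
    rw [List.append_assoc]
    exact hrz.2 _ (haz.append_left _)
  have hτ' : OnPair t.1 s.1 τ := hτ.left
  have hσ' : OnPair t.1 s.1 σ := hσ.right
  obtain ⟨g1, g2, -⟩ := hE.decomp_unique' hN hts hw.1 hl (by simp [hτ', hσ'])
    (by simp [hv, ha]) hm hm0 e1 e2
  have hg := hE.geod_cons hN hts (u := τ ++ σ) (by simp [hτ', hσ']) hw hl e1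
  refine hE.two_blocks (α := t :: τ) (β := σ) (u := u ++ a) (s := s) hts (by simp [hτ]) hσ
    (by simp) hg rfl (by simp [hu, ha]) ?_ ?_
  · exact hE.trans (hE.cons t g1) (hE.append_right a he)
  · simp only [List.length_append, List.length_cons] at g2 ⊢
    omega

theorem MoveDesc.hasDesc (hE : DihedralSystem E) (hN : EquivUpTo E N)
    (hK : MoveDesc E t w s) (hw : IsRed E (t :: w)) (hl : w.length ≤ N) {τ : Word X}
    (hτ : OnPair t.1 t.1 τ) (h1 : WordEquiv E w (τ ++ h)) (hh : ¬ HasDesc E h t.1) :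
    HasDesc E h s.1 := by
  obtain ⟨p, z, hp0, hp, hz⟩ := hK.exists_split hE hN hw hl hτ (σ := []) (h := h) (by simp)
    (by simpa using h1)
  obtain ⟨r, p, rfl⟩ := List.exists_cons_of_ne_nil hp0
  rcases (onPair_cons.1 hp).1 with hr | hr
  · exact (hh ⟨r, p ++ z, hr, hz⟩).elim
  · exact ⟨r, p ++ z, hr, hz⟩

theorem MoveDesc.hasDesc' (hE : DihedralSystem E) (hN : EquivUpTo E N)
    (hK : MoveDesc E t w s) (hw : IsRed E (t :: w)) (hl : w.length ≤ N) {τ σ : Word X}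
    (hτ : OnPair t.1 t.1 τ) (hσ : OnPair s.1 s.1 σ) (h1 : WordEquiv E w (τ ++ σ ++ h))
    (hh : ¬ HasDesc E h s.1) : HasDesc E h t.1 := by
  obtain ⟨p, z, hp0, hp, hz⟩ := hK.exists_split hE hN hw hl hτ hσ h1
  obtain ⟨r, p, rfl⟩ := List.exists_cons_of_ne_nil hp0
  rcases (onPair_cons.1 hp).1 with hr | hr
  · exact ⟨r, p ++ z, hr, hz⟩
  · exact (hh ⟨r, p ++ z, hr, hz⟩).elim

theorem exists_block (hN : EquivUpTo E N) (x : X) (hw : IsRed E w) (hl : w.length ≤ N) :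
    ∃ τ h, OnPair x x τ ∧ WordEquiv E w (τ ++ h) ∧ ¬ HasDesc E h x := by
  obtain ⟨τ, h, hτ, h1, hm, -⟩ := exists_decomp hN x x _ w rfl hl hw
  exact ⟨τ, h, hτ, h1, hm⟩

/-- The descent argument: no third generator can occur as a first letter. -/
theorem not_hasDesc_third (hE : DihedralSystem E) (hN : EquivUpTo E N) :
    ∀ (n : ℕ) {w h τ : Word X} {t s : X × Bool} {x : X}, w.length = n → n ≤ N →
    IsRed E (t :: w) → MoveDesc E t w s → OnPair t.1 t.1 τ → WordEquiv E w (τ ++ h) →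
    ¬ HasDesc E h t.1 → x ≠ s.1 → x ≠ t.1 → ¬ HasDesc E h x := by
  intro n
  induction n using Nat.strong_induction_on with
  | _ n ih =>
  intro w h τ t s x hwn hnN hw hK hτ hwh hht hxs hxt hhx
  have hlw := hwh.length_eq
  simp only [List.length_append] at hlw
  have hrh := hN _ hw.1 (by omega) _ hwh
  have hh : IsRed E h := isRed_suffix _ hrh.1
  obtain ⟨s', h1, hs', e1⟩ := hK.hasDesc hE hN hw (by omega) hτ hwh hht
  obtain ⟨r', h2, rfl, e2⟩ := hhx
  have hr1 := hN _ hh (by omega) _ e1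
  have hl1 := e1.length_eq
  simp only [List.length_cons] at hl1
  have e3 : WordEquiv E (s' :: h1) (r' :: h2) :=
    (hN _ hr1.1 (by simp; omega) _ (e1.symm hE)).2 _ e2
  have hK' : MoveDesc E s' h1 r' := moveDesc_of_wordEquiv (by rw [hs']; exact hxs.symm) e3
  obtain ⟨σ, h', hσ, e4, hh'⟩ := exists_block hN s'.1 hr1.1.1 (by omega)
  have e5 : WordEquiv E w (τ ++ (s' :: σ) ++ h') := by
    rw [List.append_assoc]
    exact hrh.2 _ ((hr1.2 _ (e4.cons s')).append_left τ)
  have hd : HasDesc E h' t.1 := hK.hasDesc' hE hN hw (by omega) hτ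
    (σ := s' :: σ) (by rw [onPair_cons, ← hs']; exact ⟨by simp, hσ⟩) e5 (hs' ▸ hh')
  exact ih h1.length (by omega) rfl (by omega) hr1.1 hK' hσ e4 hh' hxt.symm
    (by rw [hs']; exact hK.1) hd

theorem not_moveDesc_third (hE : DihedralSystem E) (hN : EquivUpTo E N) (hw : IsRed E (t :: w))
    (hl : w.length ≤ N) (hK : MoveDesc E t w s) (hK' : MoveDesc E t w r) : s.1 = r.1 := by
  by_contra hsr
  obtain ⟨τ, h, hτ, e, hh⟩ := exists_block hN t.1 hw.1 hl
  exact hE.not_hasDesc_third hN _ rfl hl hw hK hτ e hh (Ne.symm hsr) hK'.1.symm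
    (hK'.hasDesc hE hN hw hl hτ e hh)

theorem isRed_of_move (hE : DihedralSystem E) (hN : EquivUpTo E N) (hst : s.1 ≠ t.1)
    (hu : OnPair s.1 t.1 u) (hv : OnPair s.1 t.1 v) (he : E s.1 t.1 (s :: u) (t :: v))
    (hl : u.length = v.length) (h1 : WordEquiv E w (u ++ z)) (h2 : WordEquiv E w' (v ++ z))
    (hw : IsRed E (s :: w)) (hlw : w.length ≤ N) : IsRed E (t :: w') := by
  have hr1 := hN _ hw.1 hlw _ h1
  have hl1 := h1.length_eq
  have hl2 := h2.length_eq
  simp only [List.length_append] at hl1 hl2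
  obtain ⟨a, z0, ha, haz, hm⟩ := exists_decomp hN s.1 t.1 _ z rfl (by omega)
    (isRed_suffix _ hr1.1)
  have hlz := haz.length_eq
  simp only [List.length_append] at hlz
  have hrz := hN _ (isRed_suffix _ hr1.1) (by omega) _ haz
  have e1 : WordEquiv E w ((u ++ a) ++ z0) := by
    rw [List.append_assoc]
    exact hr1.2 _ (haz.append_left _)
  have hg : PairGeod E s.1 t.1 (s :: (u ++ a)) :=
    hE.geod_cons hN hst (by simp [hu, ha]) hw hlw e1
  have hg' : PairGeod E s.1 t.1 (t :: (v ++ a)) :=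
    hE.geod_congr hg (hE.append_right a he) (by simp [hl])
  have hr : IsRed E ((v ++ a) ++ z0) :=
    hE.isRed_append hN hst (isRed_suffix _ hrz.1) hm (by simp [hv, ha])
      (hE.geod_tail (.inr rfl) hg') (by simp; omega)
  have hlr : ((v ++ a) ++ z0).length ≤ N := by simp; omega
  have e2 : WordEquiv E ((v ++ a) ++ z0) (v ++ z) := by
    rw [List.append_assoc]
    exact (haz.symm hE).append_left v
  have e3 : WordEquiv E ((v ++ a) ++ z0) w' := (hN _ hr hlr _ e2).2 _ (h2.symm hE)
  refine ⟨(hN _ hr hlr _ e3).1, fun w'' hw'' => ?_⟩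
  have e4 := (hN _ hr hlr _ e3).2 _ hw''
  have hl4 := e4.length_eq
  simp only [List.length_cons] at hl4
  have hr4 := hN _ hr hlr _ e4
  obtain ⟨q, z2, hq, hqz, hm2⟩ := exists_decomp hN s.1 t.1 _ w'' rfl (by omega) hr4.1.1
  obtain ⟨g1, g2, -⟩ := hE.decomp_unique' hN hst hr hlr (u := v ++ a) (v := letterInv t :: q)
    (by simp [hv, ha]) (by simp [hq]) hm hm2 (.refl _) (hr4.2 _ (.cons _ hqz))
  have := hg' q hq (hE.cons_of_inv g1)
  simp only [List.length_cons] at g2 this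
  omega

theorem trans_move_move (hE : DihedralSystem E) (hN : EquivUpTo E N) {u' v' z' w'' : Word X}
    (hst : s.1 ≠ t.1) (hu : OnPair s.1 t.1 u) (hv : OnPair s.1 t.1 v)
    (he : E s.1 t.1 (s :: u) (t :: v)) (hl : u.length = v.length)
    (h1 : WordEquiv E w (u ++ z)) (h2 : WordEquiv E w' (v ++ z))
    (htr : t.1 ≠ r.1) (hu' : OnPair t.1 r.1 u') (hv' : OnPair t.1 r.1 v')
    (he' : E t.1 r.1 (t :: u') (r :: v')) (hl' : u'.length = v'.length)
    (h1' : WordEquiv E w' (u' ++ z')) (h2' : WordEquiv E w'' (v' ++ z'))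
    (hw : IsRed E (s :: w)) (hw' : IsRed E (t :: w')) (hlw : w.length ≤ N)
    (hlw' : w'.length ≤ N) : WordEquiv E (s :: w) (r :: w'') := by
  have hsr : s.1 = r.1 := hE.not_moveDesc_third hN hw' hlw'
    ⟨hst.symm, u, v, z, hu.swap, hv.swap, hE.swap (hE.symm he), hl.symm, h2⟩
    ⟨htr, v', u', z', hv', hu', he', hl', h1'⟩
  have hr2 := hN _ hw'.1 hlw' _ h2
  have hr2' := hN _ hw'.1 hlw' _ h1'
  have l1 := h1.length_eq
  have l2 := h2.length_eq
  have l3 := h1'.length_eq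
  have l4 := h2'.length_eq
  simp only [List.length_append] at l1 l2 l3 l4
  obtain ⟨a, z0, ha, haz, hm⟩ := exists_decomp hN s.1 t.1 _ z rfl (by omega)
    (isRed_suffix _ hr2.1)
  obtain ⟨a', z0', ha', haz', hm'⟩ := exists_decomp hN s.1 t.1 _ z' rfl (by omega)
    (isRed_suffix _ hr2'.1)
  have e2 : WordEquiv E w' ((v ++ a) ++ z0) := by
    rw [List.append_assoc]
    exact hr2.2 _ (haz.append_left _)
  have e2' : WordEquiv E w' ((u' ++ a') ++ z0') := by
    rw [List.append_assoc]
    exact hr2'.2 _ (haz'.append_left _)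
  rw [← hsr] at hu' hv' he'
  replace hu' := hu'.swap
  replace hv' := hv'.swap
  replace he' := hE.swap he'
  obtain ⟨g1, g2, g3⟩ := hE.decomp_unique' hN hst hw'.1 hlw' (u := v ++ a) (v := u' ++ a')
    (by simp [hv, ha]) (by simp [hu', ha']) hm hm' e2 e2'
  have e1 : WordEquiv E w ((u ++ a) ++ z0) := by
    rw [List.append_assoc]
    exact (hN _ hw.1 hlw _ h1).2 _ (haz.append_left _)
  have hg : PairGeod E s.1 t.1 (s :: (u ++ a)) :=
    hE.geod_cons hN hst (by simp [hu, ha]) hw hlw e1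
  have hEq : E s.1 t.1 (s :: (u ++ a)) (r :: (v' ++ a')) :=
    hE.trans (hE.append_right a he) (hE.trans (hE.cons t g1) (hE.append_right a' he'))
  have hlen : (u ++ a).length = (v' ++ a').length := by
    simp only [List.length_append] at g2 ⊢
    omega
  rcases eq_or_eq_letterInv hsr with rfl | rfl
  · refine .cons _ ?_
    have e3 : WordEquiv E ((u ++ a) ++ z0) ((v' ++ a') ++ z0) :=
      hE.wordEquiv_of_geod hst (by simp [hu, ha]) (by simp [hv', ha']) (hE.geod_tail (.inl rfl) hg)
        (hE.cancel hEq) hlen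
    have e4 : WordEquiv E ((v' ++ a') ++ z0') w'' := by
      have hz' : WordEquiv E ((v' ++ a') ++ z0') (v' ++ z') := by
        rw [List.append_assoc]
        exact (haz'.symm hE).append_left _
      have k1 := (hN _ hw.1 hlw _ e1).2 _ e3
      have k2 := (hN _ hw.1 hlw _ k1).2 _ (g3.append_left _)
      have k3 := (hN _ hw.1 hlw _ k2).1
      have l5 := k2.length_eq
      exact (hN _ k3 (by omega) _ hz').2 _ (h2'.symm hE)
    have k1 := (hN _ hw.1 hlw _ e1).2 _ e3
    have k2 := (hN _ hw.1 hlw _ k1).2 _ (g3.append_left _)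
    exact (hN _ hw.1 hlw _ k2).2 _ e4
  · exact (hE.not_inv hst (by simp [hu, ha]) (by simp [hv', ha']) hg hEq hlen).elim

theorem equivUpTo (hE : DihedralSystem E) : ∀ N, EquivUpTo E N
  | 0 => by
    intro w hw hl w' h
    obtain rfl : w = [] := by simpa using hl
    obtain rfl : w' = [] := by simpa [eq_comm] using h.length_eq
    exact ⟨hw, fun _ h => h⟩
  | N + 1 => by
    have hN := hE.equivUpTo N
    have hred : ∀ w, IsRed E w → w.length ≤ N + 1 → ∀ w', WordEquiv E w w' → IsRed E w' := by
      intro w hw hl w' h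
      rcases h with _ | ⟨s, h⟩ | ⟨hst, ha, hb, he, hlu, h1, h2⟩
      · exact hw
      · simp only [List.length_cons, add_le_add_iff_right] at hl
        have := hN _ hw.1 hl _ h
        have hl' := h.length_eq
        refine ⟨this.1, fun w'' h' => hw.2 w'' (this.2 _ h')⟩
      · exact hE.isRed_of_move hN hst ha hb he hlu h1 h2 hw (by simpa using hl)
    intro w hw hl w' h
    have hw' := hred w hw hl w' h
    refine ⟨hw', fun w'' h' => ?_⟩
    rcases h with _ | ⟨s, h⟩ | ⟨hst, ha, hb, he, hlu, h1, h2⟩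
    · exact h'
    · simp only [List.length_cons, add_le_add_iff_right] at hl
      have key := hN _ hw.1 hl _ h
      rcases h' with _ | ⟨_, h'⟩ | ⟨hst', ha', hb', he', hlu', h1', h2'⟩
      · exact .cons _ (key.2 _ h')
      · exact .move hst' ha' hb' he' hlu' (key.2 _ h1') h2'
    · simp only [List.length_cons, add_le_add_iff_right] at hl
      have l1 := h1.length_eq
      have l2 := h2.length_eq
      simp only [List.length_append] at l1 l2
      rcases h' with _ | ⟨_, h'⟩ | ⟨hst', ha', hb', he', hlu', h1', h2'⟩
      · have k := hN _ hw'.1 (by omega) _ h'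
        have l3 := h'.length_eq
        exact .move hst ha hb he hlu h1 ((hN _ k.1 (by omega) _ (h'.symm hE)).2 _ h2)
      · exact hE.trans_move_move hN hst ha hb he hlu h1 h2 hst' ha' hb' he' hlu' h1' h2' hw hw' hl
          (by omega)

/-- In a system of dihedral type, a reduced word whose first two letters are distinct generators
cannot be rewritten to start with a third generator. -/
theorem not_hasDesc_cons_cons (hE : DihedralSystem E) (hst : s.1 ≠ t.1)
    (hw : IsRed E (s :: t :: w)) (hxs : x ≠ s.1) (hxt : x ≠ t.1) :
    ¬ HasDesc E (s :: t :: w) x := by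
  rintro ⟨r, w', rfl, h⟩
  have hN := hE.equivUpTo (t :: w).length
  have hK := moveDesc_of_wordEquiv (Ne.symm hxs) h
  obtain ⟨τ, h', hτ, e, hh⟩ := exists_block hN s.1 hw.1 le_rfl
  have hk := hK.hasDesc hE hN hw le_rfl hτ e hh
  refine hE.not_hasDesc_third hN _ rfl le_rfl hw hK hτ e hh (Ne.symm hxt) (Ne.symm hst) ?_
  rcases τ with _ | ⟨s', τ⟩
  · have k := hN _ hw.1 le_rfl _ e
    exact ⟨t, w, rfl, e.symm hE⟩
  · have k := hN _ hw.1 le_rfl _ e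
    have hs' : s'.1 = s.1 := by simpa using (onPair_cons.1 hτ).1
    have hl := e.length_eq
    simp only [List.length_cons, List.cons_append, add_left_inj] at hl
    have hK' : MoveDesc E s' (τ ++ h') t :=
      moveDesc_of_wordEquiv (by rw [hs']; exact hst) (e.symm hE)
    exact hK'.hasDesc hE hN k.1 (by simp [hl]) (by rw [hs']; exact (onPair_cons.1 hτ).2)
      (.refl _) (by rwa [hs'])

end DihedralSystem
/-! ### Evaluation of words -/

section EvalWord

variable {X G : Type*} [Group G]

@[simp] theorem evalWord_nil (f : X → G) : evalWord f [] = 1 := rfl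

theorem evalWord_cons (f : X → G) (s : X × Bool) (w : Word X) :
    evalWord f (s :: w) = evalWord f [s] * evalWord f w := by
  simp [evalWord]

@[simp] theorem evalWord_append (f : X → G) (u v : Word X) :
    evalWord f (u ++ v) = evalWord f u * evalWord f v := by
  simp [evalWord]

@[simp] theorem evalWord_letterInv (f : X → G) (s : X × Bool) :
    evalWord f [letterInv s] = (evalWord f [s])⁻¹ := by
  obtain ⟨x, b⟩ := s
  cases b <;> simp [evalWord, letterInv]

theorem map_evalWord {H : Type*} [Group H] (φ : G →* H) (f : X → G) (w : Word X) :
    φ (evalWord f w) = evalWord (φ ∘ f) w := by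
  induction w with
  | nil => simp
  | cons s w ih =>
    rw [evalWord_cons, evalWord_cons (φ ∘ f), map_mul, ih]
    congr 1
    obtain ⟨x, b⟩ := s
    cases b <;> simp [evalWord]

/-- The formal inverse of a word. -/
def wordInv (w : Word X) : Word X := (w.map letterInv).reverse

@[simp] theorem length_wordInv (w : Word X) : (wordInv w).length = w.length := by simp [wordInv]

@[simp] theorem evalWord_wordInv (f : X → G) (w : Word X) :
    evalWord f (wordInv w) = (evalWord f w)⁻¹ := by
  induction w with
  | nil => simp [wordInv]
  | cons s w ih =>
    have : wordInv (s :: w) = wordInv w ++ [letterInv s] := by simp [wordInv]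
    rw [this, evalWord_append, ih, evalWord_cons f s w, evalWord_letterInv, mul_inv_rev]

theorem wordInv_wordInv (w : Word X) : wordInv (wordInv w) = w := by
  simp [wordInv, Function.comp_def]

theorem IsGeodesic.wordInv {f : X → G} {w : Word X} (h : IsGeodesic f w) :
    IsGeodesic f (wordInv w) := by
  intro v hv
  have := h (_root_.wordInv v) (by simp [hv])
  simpa using this

/-- The positive alternating word of length `n` in `x, y` starting with `x`. -/
def altWord : ℕ → X → X → Word X
  | 0, _, _ => []
  | n + 1, x, y => (x, true) :: altWord n y x

theorem lift_altProd (f : X → G) (n : ℕ) : ∀ x y : X,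
    FreeGroup.lift f (altProd n x y) = evalWord f (altWord n x y) := by
  induction n with
  | zero => simp [altProd, altWord]
  | succ n ih =>
    intro x y
    rw [altProd, altWord, map_mul, ih, evalWord_cons]
    simp [evalWord]

theorem onPair_altWord (n : ℕ) : ∀ x y : X, OnPair x y (altWord n x y) := by
  induction n with
  | zero => simp [altWord]
  | succ n ih => exact fun x y => by simp [altWord, (ih y x).swap]

theorem evalWord_artinGen_altWord (m : X → X → ℕ∞) {x y : X} (hxy : x ≠ y) {k : ℕ}
    (hk : m x y = k) : evalWord (artinGen m) (altWord k x y) =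
      evalWord (artinGen m) (altWord k y x) := by
  have key : ∀ u : FreeGroup X, FreeGroup.lift (artinGen m) u = PresentedGroup.mk (artinRels m) u :=
    fun u => by
      have : FreeGroup.lift (artinGen m) = PresentedGroup.mk (artinRels m) := by
        ext x
        simp [artinGen, PresentedGroup.of]
      rw [this]
  rw [← lift_altProd, ← lift_altProd, key, key, ← mul_inv_eq_one, ← map_inv, ← map_mul]
  exact PresentedGroup.one_of_mem ⟨x, y, k, hxy, hk, rfl⟩

/-- A map to a group compatible with the Artin relations extends to the Artin group. -/
theorem exists_artinGroup_hom (m : X → X → ℕ∞) (f : X → G)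
    (h : ∀ (x y : X) (k : ℕ), x ≠ y → m x y = k →
      evalWord f (altWord k x y) = evalWord f (altWord k y x)) :
    ∃ φ : ArtinGroup m →* G, φ ∘ artinGen m = f := by
  refine ⟨PresentedGroup.toGroup (f := f) ?_, ?_⟩
  · rintro r ⟨x, y, k, hxy, hk, rfl⟩
    rw [map_mul, map_inv, lift_altProd, lift_altProd, h x y k hxy hk, mul_inv_cancel]
  · ext x
    simp [artinGen]

end EvalWord

/-! ### Reduced words are geodesic -/

namespace DihedralSystem

variable {X : Type*} {E : X → X → Word X → Word X → Prop}

theorem isRed_of_wordEquiv (hE : DihedralSystem E) {w w' : Word X} (hw : IsRed E w)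
    (h : WordEquiv E w w') : IsRed E w' :=
  (hE.equivUpTo _ w hw le_rfl w' h).1

theorem wordEquiv_trans (hE : DihedralSystem E) {w w' w'' : Word X} (hw : IsRed E w)
    (h : WordEquiv E w w') (h' : WordEquiv E w' w'') : WordEquiv E w w'' :=
  (hE.equivUpTo _ w hw le_rfl w' h).2 w'' h'

/-- Equivalence of reduced words. -/
def redSetoid (hE : DihedralSystem E) : Setoid {w : Word X // IsRed E w} where
  r u v := WordEquiv E u.1 v.1
  iseqv := ⟨fun _ => .refl _, fun h => h.symm hE, fun {u _ _} h h' => hE.wordEquiv_trans u.2 h h'⟩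

/-- Classes of reduced words. -/
abbrev RedClass (hE : DihedralSystem E) : Type _ := Quotient hE.redSetoid

/-- The class of a reduced word. -/
def redMk (hE : DihedralSystem E) (w : Word X) (hw : IsRed E w) : hE.RedClass :=
  Quotient.mk hE.redSetoid ⟨w, hw⟩

theorem redMk_eq (hE : DihedralSystem E) {w w' : Word X} {hw : IsRed E w} {hw' : IsRed E w'} :
    hE.redMk w hw = hE.redMk w' hw' ↔ WordEquiv E w w' :=
  Quotient.eq (r := hE.redSetoid)

/-- `q'` is obtained from `q` by multiplication with the letter `s`. -/
inductive Step (hE : DihedralSystem E) (s : X × Bool) : hE.RedClass → hE.RedClass → Prop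
  | push {w : Word X} (hw : IsRed E (s :: w)) : Step hE s (hE.redMk w hw.1) (hE.redMk (s :: w) hw)
  | pop {w : Word X} (hw : IsRed E (letterInv s :: w)) :
      Step hE s (hE.redMk (letterInv s :: w) hw) (hE.redMk w hw.1)

theorem Step.inv {hE : DihedralSystem E} {s : X × Bool} {q q' : hE.RedClass} (h : Step hE s q q') :
    Step hE (letterInv s) q' q := by
  cases h with
  | push hw =>
    have := Step.pop (hE := hE) (s := letterInv s) (by simpa using hw)
    simpa using this
  | pop hw => exact .push hw

theorem exists_step (hE : DihedralSystem E) (s : X × Bool) (q : hE.RedClass) :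
    ∃ q', Step hE s q q' := by
  obtain ⟨⟨w, hw⟩, rfl⟩ := Quotient.exists_rep q
  by_cases h : ∃ w', WordEquiv E w (letterInv s :: w')
  · obtain ⟨w', h⟩ := h
    have hw' := hE.isRed_of_wordEquiv hw h
    have : hE.redMk w hw = hE.redMk _ hw' := hE.redMk_eq.2 h
    refine ⟨hE.redMk w' hw'.1, ?_⟩
    change Step hE s (hE.redMk w hw) _
    rw [this]
    exact .pop hw'
  · exact ⟨_, .push ⟨hw, fun w' hw' => h ⟨w', hw'⟩⟩⟩

theorem wordEquiv_of_cons {s : X × Bool} {w w' : Word X} (h : WordEquiv E (s :: w) (s :: w')) :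
    WordEquiv E w w' := by
  rcases h with _ | ⟨_, h⟩ | ⟨hst, _⟩
  · exact h
  · exact (hst rfl).elim

theorem Step.unique {hE : DihedralSystem E} {s : X × Bool} {q q' q'' : hE.RedClass}
    (h : Step hE s q q') (h' : Step hE s q q'') : q' = q'' := by
  generalize hq : q = q0 at h'
  cases h with
  | push hw =>
    cases h' with
    | push hw' => exact hE.redMk_eq.2 (.cons s (hE.redMk_eq.1 hq))
    | pop hw' => exact (hw.2 _ (hE.redMk_eq.1 hq)).elim
  | pop hw =>
    cases h' with
    | push hw' => exact (hw'.2 _ (hE.redMk_eq.1 hq.symm)).elim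
    | pop hw' => exact hE.redMk_eq.2 (wordEquiv_of_cons (hE.redMk_eq.1 hq))

/-- The action of a letter on classes of reduced words. -/
noncomputable def stepFun (hE : DihedralSystem E) (s : X × Bool) (q : hE.RedClass) : hE.RedClass :=
  (hE.exists_step s q).choose

theorem step_stepFun (hE : DihedralSystem E) (s : X × Bool) (q : hE.RedClass) :
    Step hE s q (hE.stepFun s q) :=
  (hE.exists_step s q).choose_spec

theorem stepFun_stepFun_inv (hE : DihedralSystem E) (s : X × Bool) (q : hE.RedClass) :
    hE.stepFun (letterInv s) (hE.stepFun s q) = q :=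
  (hE.step_stepFun _ _).unique (hE.step_stepFun s q).inv

/-- The permutation of classes of reduced words induced by a generator. -/
noncomputable def genPerm (hE : DihedralSystem E) (x : X) : Equiv.Perm hE.RedClass where
  toFun := hE.stepFun (x, true)
  invFun := hE.stepFun (x, false)
  left_inv := hE.stepFun_stepFun_inv (x, true)
  right_inv := hE.stepFun_stepFun_inv (x, false)

theorem step_genPerm (hE : DihedralSystem E) (s : X × Bool) (q : hE.RedClass) :
    Step hE s q (evalWord hE.genPerm [s] q) := by
  obtain ⟨x, b⟩ := s
  cases b
  · simp only [evalWord, List.map_cons, List.map_nil, List.prod_singleton]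
    exact hE.step_stepFun (x, false) q
  · simp only [evalWord, List.map_cons, List.map_nil, List.prod_singleton]
    exact hE.step_stepFun (x, true) q

/-- The length of a class of reduced words. -/
def redLength (hE : DihedralSystem E) (q : hE.RedClass) : ℕ :=
  Quotient.lift (s := hE.redSetoid) (fun w => w.1.length) (fun _ _ h => h.length_eq) q

theorem Step.length_le {hE : DihedralSystem E} {s : X × Bool} {q q' : hE.RedClass}
    (h : Step hE s q q') : hE.redLength q' ≤ hE.redLength q + 1 := by
  cases h <;> simp [redMk, redLength]
  omega

theorem redLength_evalWord (hE : DihedralSystem E) (w : Word X) (q : hE.RedClass) :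
    hE.redLength (evalWord hE.genPerm w q) ≤ w.length + hE.redLength q := by
  induction w with
  | nil => simp
  | cons s w ih =>
    rw [evalWord_cons, Equiv.Perm.mul_apply, List.length_cons]
    have := (hE.step_genPerm s (evalWord hE.genPerm w q)).length_le
    omega

theorem evalWord_genPerm_nil (hE : DihedralSystem E) : ∀ (w : Word X) (hw : IsRed E w),
    evalWord hE.genPerm w (hE.redMk [] trivial) = hE.redMk w hw
  | [], _ => rfl
  | s :: w, hw => by
    rw [evalWord_cons, Equiv.Perm.mul_apply, hE.evalWord_genPerm_nil w hw.1]
    exact (hE.step_genPerm s _).unique (.push hw)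

theorem exists_geod (hE : DihedralSystem E) {x y : X} {v : Word X} (hv : OnPair x y v) :
    ∃ u, OnPair x y u ∧ E x y v u ∧ PairGeod E x y u := by
  induction hn : v.length using Nat.strong_induction_on generalizing v with
  | _ n ih =>
  by_cases hg : PairGeod E x y v
  · exact ⟨v, hv, hE.refl _ _ _, hg⟩
  · simp only [PairGeod, not_forall, not_le] at hg
    obtain ⟨v', hv', he, hl⟩ := hg
    obtain ⟨u, h1, h2, h3⟩ := ih _ (hn ▸ hl) hv' rfl
    exact ⟨u, h1, hE.trans he h2, h3⟩

theorem length_eq_of_geod (hE : DihedralSystem E) {x y : X} {u v : Word X} (hu : OnPair x y u)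
    (hv : OnPair x y v) (hgu : PairGeod E x y u) (hgv : PairGeod E x y v) (he : E x y u v) :
    u.length = v.length :=
  le_antisymm (hgu v hv he) (hgv u hu (hE.symm he))

theorem isRed_append' (hE : DihedralSystem E) {x y : X} (hxy : x ≠ y) {u z : Word X}
    (hz : IsRed E z) (hm : ¬ HasDesc E z x ∧ ¬ HasDesc E z y) (hu : OnPair x y u)
    (hg : PairGeod E x y u) : IsRed E (u ++ z) :=
  hE.isRed_append (hE.equivUpTo (u ++ z).length) hxy hz hm hu hg (by simp)

/-- The action of words over `x, y` on a coset with minimal representative `z`. -/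
theorem evalWord_genPerm_append (hE : DihedralSystem E) {x y : X} (hxy : x ≠ y) {z : Word X}
    (hz : IsRed E z) (hm : ¬ HasDesc E z x ∧ ¬ HasDesc E z y) : ∀ {v u : Word X}
    (_ : OnPair x y v) (hu : OnPair x y u) (hg : PairGeod E x y u) (_ : E x y v u),
    evalWord hE.genPerm v (hE.redMk z hz) =
      hE.redMk (u ++ z) (hE.isRed_append' hxy hz hm hu hg)
  | [], u, hv, _, hg, he => by
    obtain rfl : u = [] := by simpa using hg [] hv (hE.symm he)
    rfl
  | s :: v, u, hv, hu, hg, he => by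
    rw [onPair_cons] at hv
    obtain ⟨u1, hu1, he1, hg1⟩ := hE.exists_geod hv.2
    have hsu : OnPair x y (s :: u1) := by simp [hv.1, hu1]
    rw [evalWord_cons, Equiv.Perm.mul_apply,
      hE.evalWord_genPerm_append hxy hz hm hv.2 hu1 hg1 he1]
    have hst := hE.step_genPerm s (hE.redMk (u1 ++ z) (hE.isRed_append' hxy hz hm hu1 hg1))
    have he2 : E x y (s :: u1) u := hE.trans (hE.cons s (hE.symm he1)) he
    by_cases hg2 : PairGeod E x y (s :: u1)
    · have hr := hE.isRed_append' hxy hz hm hsu hg2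
      rw [hst.unique (.push hr)]
      exact hE.redMk_eq.2 (hE.wordEquiv_of_geod hxy hsu hu hg2 he2
        (hE.length_eq_of_geod hsu hu hg2 hg he2))
    · obtain ⟨q, hq, he3, hl⟩ := hE.exchange hxy hsu hg1 hg2
      have hsq : OnPair x y (letterInv s :: q) := by
        rw [onPair_cons]
        exact ⟨hv.1, hq⟩
      have hg3 : PairGeod E x y (letterInv s :: q) := hE.geod_congr hg1 he3 (by simp [hl])
      have hr := hE.isRed_append' hxy hz hm hsq hg3
      have heq : hE.redMk (u1 ++ z) (hE.isRed_append' hxy hz hm hu1 hg1) = hE.redMk _ hr :=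
        hE.redMk_eq.2 (hE.wordEquiv_of_geod hxy hu1 hsq hg1 he3 (by simp [hl]))
      rw [heq] at hst ⊢
      rw [hst.unique (.pop hr)]
      have hgq := hE.geod_tail (s := letterInv s) hv.1 hg3
      have he4 : E x y q u := hE.trans (hE.symm (hE.cons_of_inv he3)) he2
      exact hE.redMk_eq.2 (hE.wordEquiv_of_geod hxy hq hu hgq he4
        (hE.length_eq_of_geod hq hu hgq hg he4))

/-- Equivalent words over `x, y` act in the same way. -/
theorem evalWord_genPerm_congr (hE : DihedralSystem E) {x y : X} (hxy : x ≠ y) {v v' : Word X}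
    (hv : OnPair x y v) (hv' : OnPair x y v') (he : E x y v v') :
    evalWord hE.genPerm v = evalWord hE.genPerm v' := by
  ext q
  obtain ⟨⟨w, hw⟩, rfl⟩ := Quotient.exists_rep q
  obtain ⟨u, z, hu, hwz, hm⟩ := exists_decomp (hE.equivUpTo w.length) x y _ w rfl le_rfl hw
  have hr := hE.isRed_of_wordEquiv hw hwz
  have hz := isRed_suffix _ hr
  have h1 := hE.evalWord_genPerm_append hxy hz hm hu hu (hE.geod_of_isRed hxy hu hr)
    (hE.refl _ _ _)
  have h2 : (Quotient.mk hE.redSetoid ⟨w, hw⟩ : hE.RedClass) =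
      evalWord hE.genPerm u (hE.redMk z hz) := by
    rw [h1]
    exact hE.redMk_eq.2 hwz
  have hvu : OnPair x y (v ++ u) := by simp [hv, hu]
  have hvu' : OnPair x y (v' ++ u) := by simp [hv', hu]
  obtain ⟨p, hp, hep, hgp⟩ := hE.exists_geod hvu
  rw [h2, ← Equiv.Perm.mul_apply, ← Equiv.Perm.mul_apply, ← evalWord_append, ← evalWord_append,
    hE.evalWord_genPerm_append hxy hz hm hvu hp hgp hep,
    hE.evalWord_genPerm_append hxy hz hm hvu' hp hgp
      (hE.trans (hE.symm (hE.append_right u he)) hep)]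

theorem evalWord_eq_of_wordEquiv {G : Type*} [Group G] (f : X → G)
    (hf : ∀ x y u v, E x y u v → evalWord f u = evalWord f v) {w w' : Word X}
    (h : WordEquiv E w w') : evalWord f w = evalWord f w' := by
  induction h with
  | nil => rfl
  | cons s _ ih => rw [evalWord_cons, ih, ← evalWord_cons]
  | @move s t u v z w w' _ _ _ he _ _ _ ih1 ih2 =>
    rw [evalWord_cons f s w, ih1, evalWord_cons f t w', ih2, evalWord_append, evalWord_append,
      ← mul_assoc, ← mul_assoc, ← evalWord_cons f s u, ← evalWord_cons f t v, hf _ _ _ _ he]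

theorem isGeodesic_tail {G : Type*} [Group G] {f : X → G} {s : X × Bool} {w : Word X}
    (h : IsGeodesic f (s :: w)) : IsGeodesic f w := by
  intro v hv
  have := h (s :: v) (by rw [evalWord_cons, hv, ← evalWord_cons])
  simpa using this

/-- Geodesics are exactly the reduced words. -/
theorem isGeodesic_iff (hE : DihedralSystem E) (m : X → X → ℕ∞)
    (hm : ∀ (x y : X) (k : ℕ), x ≠ y → m x y = k → E x y (altWord k x y) (altWord k y x))
    (hf : ∀ x y u v, E x y u v → evalWord (artinGen m) u = evalWord (artinGen m) v) (w : Word X) :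
    IsGeodesic (artinGen m) w ↔ IsRed E w := by
  constructor
  · intro h
    induction w with
    | nil => trivial
    | cons s w ih =>
      refine ⟨ih (isGeodesic_tail h), fun w' hw' => ?_⟩
      have h1 := hw'.length_eq
      have h2 := h w' (by
        rw [evalWord_cons, evalWord_eq_of_wordEquiv _ hf hw', evalWord_cons _ (letterInv s),
          evalWord_letterInv, mul_inv_cancel_left])
      simp only [List.length_cons] at h1 h2
      omega
  · intro hw v hv
    obtain ⟨φ, hφ⟩ := exists_artinGroup_hom m hE.genPerm fun x y k hxy hk =>
      hE.evalWord_genPerm_congr hxy (onPair_altWord k x y) (onPair_altWord k y x).swap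
        (hm x y k hxy hk)
    have h1 : evalWord hE.genPerm v = evalWord hE.genPerm w := by
      rw [← hφ, ← map_evalWord, ← map_evalWord, hv]
    have h2 := hE.redLength_evalWord v (hE.redMk [] trivial)
    rw [h1, hE.evalWord_genPerm_nil w hw] at h2
    exact h2

theorem blockingPair (hE : DihedralSystem E) (m : X → X → ℕ∞)
    (hm : ∀ (x y : X) (k : ℕ), x ≠ y → m x y = k → E x y (altWord k x y) (altWord k y x))
    (hf : ∀ x y u v, E x y u v → evalWord (artinGen m) u = evalWord (artinGen m) v)
    (a b c : X × Bool) (hab : a.1 ≠ b.1) (hbc : b.1 ≠ c.1) (hac : a.1 ≠ c.1) :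
    BlockingPair (artinGen m) [a, b] c := by
  intro w hw
  have h1 : IsRed E (wordInv (w ++ [a, b])) := (hE.isGeodesic_iff m hm hf _).1 hw.wordInv
  have h2 : wordInv (w ++ [a, b]) = letterInv b :: letterInv a :: wordInv w := by simp [wordInv]
  have h3 : IsRed E (letterInv c :: wordInv (w ++ [a, b])) := by
    refine ⟨h1, fun w' hw' => ?_⟩
    rw [h2] at h1 hw'
    exact hE.not_hasDesc_cons_cons (s := letterInv b) (t := letterInv a) (x := c.1) hab.symm h1
      hbc.symm hac.symm ⟨letterInv (letterInv c), w', rfl, hw'⟩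
  have h4 := ((hE.isGeodesic_iff m hm hf _).2 h3).wordInv
  have h5 : wordInv (letterInv c :: wordInv (w ++ [a, b])) = w ++ [a, b] ++ [c] := by
    have : letterInv c :: wordInv (w ++ [a, b]) = wordInv (w ++ [a, b] ++ [c]) := by simp [wordInv]
    rw [this, wordInv_wordInv]
  rwa [h5] at h4

end DihedralSystem

/-! ### Normal forms in dihedral Artin groups -/

namespace DihedralModel

/-- Normal forms: `(k, l, b)` stands for a product of alternating positive words whose lengths are
listed in `l`, the first of them starting with the generator `b`, followed by the `k`-th power of
the Garside element. -/
abbrev Raw : Type := ℤ × List ℕ × Bool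

/-- The letter attached to an empty list of factors is fixed to be `true`. -/
def canon : List ℕ → Bool → Bool
  | [], _ => true
  | _ :: _, b => b

@[simp] theorem canon_nil (b : Bool) : canon [] b = true := rfl

@[simp] theorem canon_cons (h : ℕ) (l : List ℕ) (b : Bool) : canon (h :: l) b = b := rfl

/-- Left multiplication by the generator `g`. -/
def up (n : ℕ) (g : Bool) : Raw → Raw
  | (k, [], _) => (k, [1], g)
  | (k, h :: l, b) =>
    if b = g then (k, 1 :: h :: l, g)
    else if h + 1 < n then (k, (h + 1) :: l, g) else (k + 1, l, canon l b)

/-- Left multiplication by the inverse of the generator `g`. -/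
def down (n : ℕ) (g : Bool) : Raw → Raw
  | (k, [], _) => (k - 1, [n - 1], !g)
  | (k, h :: l, b) =>
    if b = g then if h = 1 then (k, l, canon l g) else (k, (h - 1) :: l, !g)
    else (k - 1, (n - 1) :: h :: l, b)

/-- Admissible normal forms. -/
def Valid (n : ℕ) (d : Raw) : Prop :=
  (∀ h ∈ d.2.1, 1 ≤ h ∧ h < n) ∧ (d.2.1 = [] → d.2.2 = true)

variable {n : ℕ} {g : Bool} {d : Raw}

theorem Valid.up (hn : 2 ≤ n) (hd : Valid n d) : Valid n (up n g d) := by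
  obtain ⟨k, l, b⟩ := d
  rcases l with _ | ⟨h, l⟩
  · simp [DihedralModel.up, Valid]
    omega
  · obtain ⟨hd, -⟩ := hd
    simp only [List.mem_cons, forall_eq_or_imp] at hd
    simp only [DihedralModel.up]
    split_ifs
    · simp [Valid]
      grind
    · simp [Valid]
      grind
    · refine ⟨hd.2, ?_⟩
      rintro rfl
      rfl

theorem Valid.down (hn : 2 ≤ n) (hd : Valid n d) : Valid n (down n g d) := by
  obtain ⟨k, l, b⟩ := d
  rcases l with _ | ⟨h, l⟩
  · simp [DihedralModel.down, Valid]
    omega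
  · obtain ⟨hd, -⟩ := hd
    simp only [List.mem_cons, forall_eq_or_imp] at hd
    simp only [DihedralModel.down]
    split_ifs
    · refine ⟨hd.2, ?_⟩
      rintro rfl
      rfl
    · simp [Valid]
      grind
    · simp [Valid]
      grind

theorem down_up (hn : 2 ≤ n) (hd : Valid n d) : down n g (up n g d) = d := by
  obtain ⟨k, l, b⟩ := d
  rcases l with _ | ⟨h, l⟩
  · obtain rfl : b = true := hd.2 rfl
    simp [up, down]
  · have h1 := hd.1 h (by simp)
    simp only [up]
    split_ifs with h2 h3
    · simp [down, h2]
    · have : h ≠ 0 := by omega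
      simp [down, this]
      cases b <;> cases g <;> simp_all
    · obtain rfl : h = n - 1 := by omega
      rcases l with _ | ⟨h', l⟩
      · simp [down]
        cases b <;> cases g <;> simp_all
      · simp [down, h2]

theorem up_down (hn : 2 ≤ n) (hd : Valid n d) : up n g (down n g d) = d := by
  have hn' : n - 1 + 1 = n := by omega
  obtain ⟨k, l, b⟩ := d
  rcases l with _ | ⟨h, l⟩
  · obtain rfl : b = true := hd.2 rfl
    simp [up, down, hn']
  · have h1 := hd.1 h (by simp)
    simp only [down]
    split_ifs with h2 h3
    · subst h2 h3
      rcases l with _ | ⟨h', l⟩ <;> simp [up]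
    · have : h - 1 + 1 = h := by omega
      simp [up, this, h1, h2]
    · simp [up, h2, hn']

/-- Successive left multiplication by the letters of an alternating word of length `j` starting
with `g`. -/
def altUp (n : ℕ) : ℕ → Bool → Raw → Raw
  | 0, _, d => d
  | j + 1, g, d => up n g (altUp n j (!g) d)

/-- The first letter of the word obtained by removing `j` letters from an alternating word
starting with `g`. -/
def shift (j : ℕ) (g : Bool) : Bool := if Even j then g else !g

theorem shift_succ (j : ℕ) (g : Bool) : shift (j + 1) g = shift j (!g) := by
  simp only [shift, Nat.even_add_one]
  split_ifs <;> simp_all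

theorem shift_succ' (j : ℕ) (g : Bool) : shift (j + 1) g = !shift j g := by
  simp only [shift, Nat.even_add_one]
  split_ifs <;> simp_all

@[simp] theorem shift_not (j : ℕ) (g : Bool) : shift j (!g) = !shift j g := by
  rw [← shift_succ, shift_succ']

@[simp] theorem shift_shift (j : ℕ) (g : Bool) : shift j (shift j g) = g := by
  simp only [shift]
  split_ifs <;> simp

theorem altUp_push {k : ℤ} {l : List ℕ} {b : Bool} : ∀ {j : ℕ} {g : Bool}, j + 1 < n →
    (l ≠ [] → b = shift j g) → altUp n (j + 1) g (k, l, b) = (k, (j + 1) :: l, g)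
  | 0, g, _, hb => by
    rcases l with _ | ⟨h, l⟩
    · simp [altUp, up]
    · simp [altUp, up, hb, shift]
  | j + 1, g, hj, hb => by
    rw [altUp, altUp_push (by omega) (fun hl => by rw [hb hl, shift_succ])]
    simp [up, hj]

theorem altUp_extend {k : ℤ} {l : List ℕ} {b : Bool} {h : ℕ} : ∀ {j : ℕ} {g : Bool}, h + j < n →
    b = shift j g → altUp n j g (k, h :: l, b) = (k, (h + j) :: l, g)
  | 0, g, _, hb => by simp [altUp, hb, shift]
  | j + 1, g, hj, hb => by
    rw [altUp, altUp_extend (by omega) (by rw [hb, shift_succ])]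
    simp [up, ← add_assoc]
    omega

theorem altUp_wrap {k : ℤ} {l : List ℕ} {b : Bool} {h i : ℕ} (hh : 1 ≤ h) (hi : i + h + 1 = n) :
    ∀ {j : ℕ} {g : Bool}, j + 1 < n → b = shift (i + 1 + j) g →
    altUp n (i + 1 + (j + 1)) (!g) (k, h :: l, b) = (k + 1, (j + 1) :: l, !g)
  | 0, g, hj, hb => by
    rw [altUp, altUp, altUp_extend (j := i) (by omega) (by simpa [shift_succ] using hb)]
    rcases l with _ | ⟨h', l⟩ <;> simp [up] <;> simp [show ¬ (h + i + 1 < n) by omega]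
  | j + 1, g, hj, hb => by
    have := altUp_wrap hh hi (k := k) (l := l) (b := b) (j := j) (g := !g) (by omega)
      (by rw [hb, ← shift_succ]; rfl)
    rw [← add_assoc, altUp, this]
    simp [up]
    omega

/-- The action of the Garside element. -/
theorem altUp_full (hn : 2 ≤ n) {k : ℤ} {l : List ℕ} {b : Bool} (hd : Valid n (k, l, b)) :
    altUp n n g (k, l, b) = (k + 1, l, canon l (shift n b)) := by
  obtain ⟨j, rfl⟩ : ∃ j, n = j + 1 + 1 := ⟨n - 2, by omega⟩
  rcases l with _ | ⟨h, l⟩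
  · rw [altUp, altUp_push (by omega) (by simp)]
    simp [up]
  · have hh := hd.1 h (by simp)
    by_cases hb : b = shift (j + 1) g
    · rw [altUp, altUp_push (by omega) (fun _ => by rw [hb, shift_succ])]
      have : shift (j + 1 + 1) b = !g := by rw [shift_succ', hb, shift_shift]
      simp [up, this]
    · obtain ⟨i, hi⟩ : ∃ i, j + 1 = i + h := ⟨j + 1 - h, by omega⟩
      obtain ⟨h, rfl⟩ : ∃ h', h = h' + 1 := ⟨h - 1, by omega⟩
      have hb' : b = shift (j + 1 + 1) g := by
        rw [shift_succ']
        cases b <;> cases h : shift (j + 1) g <;> simp_all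
      have h1 := altUp_wrap (n := j + 1 + 1) (k := k) (l := l) (b := b) (h := h + 1) (i := i)
        (j := h) (g := !g) (by omega) (by omega) (by omega) (by
          rw [hb', shift_succ]
          congr 1
          omega)
      rw [Bool.not_not, show i + 1 + (h + 1) = j + 1 + 1 by omega] at h1
      rw [h1, hb', shift_shift, canon_cons]

/-- The family of potentials, indexed by `t`, whose maximum over `0 ≤ t ≤ n` is the word length. -/
def pot (n : ℕ) (t : ℤ) (d : Raw) : ℤ :=
  -d.1 * (n - 2 * t) + (d.2.1.map fun h : ℕ => min (h : ℤ) (2 * t - h)).sum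

/-- Multiplication by `g` increases the potential exactly for `t` above this threshold. -/
def thr (g : Bool) : Raw → ℕ
  | (_, [], _) => 0
  | (_, h :: _, b) => if b = g then 0 else h

theorem pot_up (hd : Valid n d) {t : ℤ} (h0 : 0 ≤ t) (ht : t ≤ n) :
    pot n t (up n g d) = pot n t d + if (thr g d : ℤ) < t then 1 else -1 := by
  obtain ⟨k, l, b⟩ := d
  rcases l with _ | ⟨h, l⟩
  · simp [pot, up, thr]
    split_ifs <;> omega
  · have h1 := hd.1 h (by simp)
    simp only [up, thr]
    split_ifs with h2 h3 h3 h4 h4 <;> simp [pot]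
    · simp at h3
      omega
    · simp at h3
      omega
    · omega
    · omega
    · obtain rfl : t = n := by omega
      have : min (h : ℤ) (2 * n - h) = n - 1 := by omega
      rw [this]
      ring
    · have : min (h : ℤ) (2 * t - h) = 2 * t - n + 1 := by omega
      rw [this]
      ring

theorem pot_down (hn : 2 ≤ n) (hd : Valid n d) {t : ℤ} (h0 : 0 ≤ t) (ht : t ≤ n) :
    pot n t (down n g d) = pot n t d + if t ≤ (thr g (down n g d) : ℤ) then 1 else -1 := by
  have := pot_up (g := g) (hd.down (g := g) hn) h0 ht
  rw [up_down hn hd] at this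
  rw [this]
  split_ifs <;> omega

theorem thr_le_thr_down (hn : 2 ≤ n) (hd : Valid n d) : thr g d ≤ thr g (down n g d) := by
  obtain ⟨k, l, b⟩ := d
  rcases l with _ | ⟨h, l⟩
  · simp [thr]
  · have h1 := hd.1 h (by simp)
    simp only [thr, down]
    split_ifs <;> simp [*]
    omega

theorem pot_parity (n : ℕ) (d : Raw) (t : ℤ) : ∃ i, pot n t d = pot n 0 d + 2 * i := by
  obtain ⟨k, l, b⟩ := d
  induction l with
  | nil =>
    refine ⟨k * t, ?_⟩
    simp [pot]
    ring
  | cons h l ih =>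
    obtain ⟨i, hi⟩ := ih
    simp only [pot, List.map_cons, List.sum_cons] at hi ⊢
    rcases le_total (h : ℤ) (2 * t - h) with h1 | h1
    · refine ⟨i + h, ?_⟩
      rw [min_eq_left h1, min_eq_right (by omega)]
      linarith
    · refine ⟨i + t, ?_⟩
      rw [min_eq_right h1, min_eq_right (by omega)]
      linarith

theorem sum_concave {t₁ t₂ t : ℤ} (h1 : t₁ ≤ t) (h2 : t ≤ t₂) (l : List ℕ) :
    (t₂ - t) * (l.map fun h : ℕ => min (h : ℤ) (2 * t₁ - h)).sum +
      (t - t₁) * (l.map fun h : ℕ => min (h : ℤ) (2 * t₂ - h)).sum ≤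
      (t₂ - t₁) * (l.map fun h : ℕ => min (h : ℤ) (2 * t - h)).sum := by
  induction l with
  | nil => simp
  | cons h l ih =>
    simp only [List.map_cons, List.sum_cons]
    have : (t₂ - t) * min (h : ℤ) (2 * t₁ - h) + (t - t₁) * min (h : ℤ) (2 * t₂ - h) ≤
        (t₂ - t₁) * min (h : ℤ) (2 * t - h) := by
      rcases min_cases (h : ℤ) (2 * t - h) with ⟨e, -⟩ | ⟨e, -⟩ <;> rw [e]
      · nlinarith [min_le_left (h : ℤ) (2 * t₁ - h), min_le_left (h : ℤ) (2 * t₂ - h)]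
      · nlinarith [min_le_right (h : ℤ) (2 * t₁ - h), min_le_right (h : ℤ) (2 * t₂ - h)]
    linarith

theorem pot_concave {k : ℤ} {h : ℕ} {l : List ℕ} {b : Bool} {t₁ t₂ : ℤ} (h1 : t₁ < h)
    (h2 : h < t₂) : (t₂ - h) * pot n t₁ (k, h :: l, b) + (h - t₁) * pot n t₂ (k, h :: l, b) <
      (t₂ - t₁) * pot n h (k, h :: l, b) := by
  have := sum_concave h1.le h2.le l
  simp only [pot, List.map_cons, List.sum_cons]
  rw [min_eq_right (b := 2 * t₁ - (h : ℤ)) (by omega), min_eq_left (b := 2 * t₂ - (h : ℤ)) (by omega),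
    min_eq_left (b := 2 * (h : ℤ) - h) (by omega)]
  nlinarith [mul_pos (sub_pos.2 h2) (sub_pos.2 h1)]

theorem eq_base_of_pot (hn : 2 ≤ n) (hd : Valid n d)
    (h : ∀ t : ℤ, 0 ≤ t → t ≤ n → pot n t d ≤ 0) : d = (0, [], true) := by
  obtain ⟨k, l, b⟩ := d
  obtain ⟨hl, hb⟩ := hd
  have e0 : (l.map fun h : ℕ => min (h : ℤ) (2 * 0 - h)).sum = -(l.map Nat.cast).sum := by
    clear h hb
    induction l with
    | nil => simp
    | cons h l ih =>
      simp only [List.mem_cons, forall_eq_or_imp] at hl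
      simp only [List.map_cons, List.sum_cons, ih hl.2]
      omega
  have e1 : (l.map fun h : ℕ => min (h : ℤ) (2 * 1 - h)).sum =
      2 * l.length - (l.map Nat.cast).sum := by
    clear h hb e0
    induction l with
    | nil => simp
    | cons h l ih =>
      simp only [List.mem_cons, forall_eq_or_imp] at hl
      simp only [List.map_cons, List.sum_cons, ih hl.2, List.length_cons]
      push_cast
      omega
  have e2 : ∀ t : ℤ, n - 1 ≤ t → (l.map fun h : ℕ => min (h : ℤ) (2 * t - h)).sum =
      (l.map Nat.cast).sum := by
    intro t ht
    clear h hb e0 e1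
    induction l with
    | nil => simp
    | cons h l ih =>
      simp only [List.mem_cons, forall_eq_or_imp] at hl
      simp only [List.map_cons, List.sum_cons, ih hl.2]
      omega
  have h0 := h 0 le_rfl (by omega)
  have h1 := h 1 (by omega) (by omega)
  have h2 := h (n - 1) (by omega) (by omega)
  have h3 := h n (by omega) le_rfl
  simp only [pot] at h0 h1 h2 h3
  rw [e0] at h0
  rw [e1] at h1
  rw [e2 _ (by omega)] at h2 h3
  have hk : 0 ≤ k := by linarith
  have hr : k + l.length ≤ 0 := by linarith
  obtain rfl : l = [] := List.eq_nil_of_length_eq_zero (by omega)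
  obtain rfl : k = 0 := by simp at hr; omega
  simpa using hb

/-- If the maximal potential is positive, some letter decreases all maximal potentials. -/
theorem exists_descent (hn : 2 ≤ n) (hd : Valid n d) {N : ℕ}
    (h : ∀ t : ℤ, 0 ≤ t → t ≤ n → pot n t d ≤ N + 1) :
    (∀ t : ℤ, 0 ≤ t → t ≤ n → pot n t d ≤ N) ∨
      ∃ g, (∀ t : ℤ, 0 ≤ t → t ≤ n → pot n t (up n g d) ≤ N) ∨
        ∀ t : ℤ, 0 ≤ t → t ≤ n → pot n t (down n g d) ≤ N := by
  by_cases hmax : ∀ t : ℤ, 0 ≤ t → t ≤ n → pot n t d ≤ N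
  · exact .inl hmax
  right
  push Not at hmax
  obtain ⟨t₀, ht0, ht0', ht₀⟩ := hmax
  have hpar : ∀ t : ℤ, 0 ≤ t → t ≤ n → pot n t d = N + 1 ∨ pot n t d + 1 ≤ N := by
    intro t h1 h2
    obtain ⟨i, hi⟩ := pot_parity n d t
    obtain ⟨i', hi'⟩ := pot_parity n d t₀
    have := h t h1 h2
    have := h t₀ ht0 ht0'
    omega
  have hup : ∀ g, (∀ t : ℤ, 0 ≤ t → t ≤ n → pot n t d = N + 1 → t ≤ thr g d) →
      ∀ t : ℤ, 0 ≤ t → t ≤ n → pot n t (up n g d) ≤ N := by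
    intro g hg t h1 h2
    rw [pot_up hd h1 h2]
    rcases hpar t h1 h2 with h3 | h3
    · have := hg t h1 h2 h3
      split_ifs <;> omega
    · split_ifs <;> omega
  have hdown : ∀ g, (∀ t : ℤ, 0 ≤ t → t ≤ n → pot n t d = N + 1 → thr g (down n g d) < t) →
      ∀ t : ℤ, 0 ≤ t → t ≤ n → pot n t (down n g d) ≤ N := by
    intro g hg t h1 h2
    rw [pot_down hn hd h1 h2]
    rcases hpar t h1 h2 with h3 | h3
    · have := hg t h1 h2 h3
      split_ifs <;> omega
    · split_ifs <;> omega
  obtain ⟨k, l, b⟩ := d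
  rcases l with _ | ⟨y, l⟩
  · rcases lt_trichotomy k 0 with hk | rfl | hk
    · refine ⟨true, .inl (hup true fun t h1 h2 h3 => ?_)⟩
      have := h 0 le_rfl (by omega)
      simp [pot, thr] at *
      nlinarith
    · simp [pot] at ht₀
      omega
    · refine ⟨true, .inr (hdown true fun t h1 h2 h3 => ?_)⟩
      have := h n (by omega) le_rfl
      have : (n : ℤ) ≤ t := by
        simp [pot, thr] at *
        nlinarith
      simp [thr, down]
      omega
  · by_cases hA : ∀ t : ℤ, 0 ≤ t → t ≤ n → pot n t (k, y :: l, b) = N + 1 → t ≤ y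
    · exact ⟨!b, .inl (hup (!b) (by simpa [thr] using hA))⟩
    by_cases hB : ∀ t : ℤ, 0 ≤ t → t ≤ n → pot n t (k, y :: l, b) = N + 1 → y ≤ t
    · refine ⟨b, .inr (hdown b fun t h1 h2 h3 => ?_)⟩
      have h4 := hB t h1 h2 h3
      have h5 := hd.1 y (by simp)
      have : thr b (down n b (k, y :: l, b)) + 1 = y := by
        simp only [down, if_true]
        split_ifs with h6
        · rcases l with _ | ⟨z, l⟩ <;> simp [thr, h6]
        · simp [thr]
          omega
      omega
    push Not at hA hB
    obtain ⟨t₂, h20, h2n, h2e, h2⟩ := hA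
    obtain ⟨t₁, h10, h1n, h1e, h1⟩ := hB
    have h3 := pot_concave (n := n) (k := k) (l := l) (b := b) h1 h2
    have h4 := h y (by omega) (by omega)
    rw [h2e, h1e] at h3
    nlinarith

/-- Left multiplication by a generator or its inverse. -/
def step (n : ℕ) (g ε : Bool) (d : Raw) : Raw := if ε then up n g d else down n g d

theorem Valid.step (hn : 2 ≤ n) (hd : Valid n d) {ε : Bool} : Valid n (step n g ε d) := by
  unfold DihedralModel.step
  split_ifs
  exacts [hd.up hn, hd.down hn]

theorem step_not_step (hn : 2 ≤ n) (hd : Valid n d) {ε : Bool} :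
    step n g (!ε) (step n g ε d) = d := by
  cases ε
  · exact up_down hn hd
  · exact down_up hn hd

theorem pot_step (hn : 2 ≤ n) (hd : Valid n d) {ε : Bool} {t : ℤ} (h0 : 0 ≤ t) (ht : t ≤ n) :
    pot n t (step n g ε d) = pot n t d + 1 ∨ pot n t (step n g ε d) = pot n t d - 1 := by
  cases ε
  · have := pot_down (g := g) hn hd h0 ht
    simp only [step]
    split_ifs at this <;> simp_all [sub_eq_add_neg]
  · have := pot_up (g := g) hd h0 ht
    simp only [step]
    split_ifs at this <;> simp_all [sub_eq_add_neg]

/-- Two opposite steps cannot both decrease a potential. -/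
theorem pot_step_not (hn : 2 ≤ n) (hd : Valid n d) {ε : Bool} {t : ℤ} (h0 : 0 ≤ t) (ht : t ≤ n)
    (h : pot n t (step n g ε d) < pot n t d) : pot n t d < pot n t (step n g (!ε) d) := by
  have h1 := pot_down (g := g) hn hd h0 ht
  have h2 := pot_up (g := g) hd h0 ht
  have h3 := thr_le_thr_down (g := g) hn hd
  cases ε <;> simp [step] at h ⊢ <;> split_ifs at h1 h2 <;> omega

/-- The normal form of the trivial element. -/
def base : Raw := (0, [], true)

theorem valid_base : Valid n base := by simp [Valid, base]

@[simp] theorem pot_base (t : ℤ) : pot n t base = 0 := by simp [pot, base]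

/-- The step increases the potential at `T`. -/
def Gain (n T : ℕ) (g ε : Bool) (d : Raw) : Prop :=
  if ε then thr g d < T else T ≤ thr g (down n g d)

theorem Gain.pot_eq {T : ℕ} {ε : Bool} (h : Gain n T g ε d) (hn : 2 ≤ n) (hT : T ≤ n)
    (hd : Valid n d) : pot n T (step n g ε d) = pot n T d + 1 := by
  cases ε
  · have := pot_down (g := g) hn hd (t := T) (by omega) (by omega)
    simp [step, Gain] at *
    rw [this, if_pos h]
  · have := pot_up (g := g) hd (t := T) (by omega) (by omega)
    simp [step, Gain] at *
    rw [this, if_pos h]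

theorem iterate_step (hn : 2 ≤ n) {T : ℕ} (hT : T ≤ n) {ε : Bool} {I : Raw → Prop}
    (hI : ∀ d, I d → Gain n T g ε d ∧ I (step n g ε d)) (j : ℕ) (hd : Valid n d) (h : I d) :
    Valid n ((step n g ε)^[j] d) ∧ I ((step n g ε)^[j] d) ∧
      pot n T ((step n g ε)^[j] d) = pot n T d + j := by
  induction j with
  | zero => simp [hd, h]
  | succ j ih =>
    obtain ⟨h1, h2, h3⟩ := ih
    rw [Function.iterate_succ_apply']
    refine ⟨h1.step hn, (hI _ h2).2, ?_⟩
    rw [(hI _ h2).1.pot_eq hn hT h1, h3]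
    push_cast
    ring

/-- The first factor starts with `b` and its length satisfies `P`. -/
def Head (P : ℕ → Prop) (b : Bool) (d : Raw) : Prop := ∃ k h l, d = (k, h :: l, b) ∧ P h

theorem pot_three_blocks (hn : 3 ≤ n) (ε₁ ε₂ ε₃ : Bool) (i j : ℕ) :
    ∃ T : ℕ, T ≤ n ∧ pot n T (step n false ε₃ ((step n true ε₂)^[j + 1]
      ((step n false ε₁)^[i] base))) = i + (j + 1) + 1 := by
  have hn2 : 2 ≤ n := by omega
  have hn3 : n ≠ 2 := by omega
  have hn4 : 2 < n := hn
  obtain ⟨T, hT, I, J, K, h1, h2, h3, h4, h5⟩ : ∃ T : ℕ, T ≤ n ∧ ∃ I J K : Raw → Prop,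
      (∀ d, I d → Gain n T false ε₁ d ∧ I (step n false ε₁ d)) ∧
      (∀ d, I d → Gain n T true ε₂ d ∧ J (step n true ε₂ d)) ∧
      (∀ d, J d → Gain n T true ε₂ d ∧ J (step n true ε₂ d)) ∧
      (∀ d, J d → Gain n T false ε₃ d ∧ K (step n false ε₃ d)) ∧ I base := by
    refine ⟨ε₁.toNat + ε₂.toNat + ε₃.toNat, ?_, ?_⟩
    · have := ε₁.toNat_le
      have := ε₂.toNat_le
      have := ε₃.toNat_le
      omega
    refine ⟨fun d => d = base ∨ Head (fun h => h = if ε₁ then 1 else n - 1) (!ε₁) d,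
      Head (fun h => if ε₂ then h = 1 ∨ (h = 2 ∧ ε₁) else h = n - 1 ∨ (h = n - 2 ∧ !ε₁)) ε₂,
      fun _ => True, ?_, ?_, ?_, ?_, .inl rfl⟩
    · rintro d (rfl | ⟨k, h, l, rfl, rfl⟩) <;> cases ε₁ <;> cases ε₂ <;> cases ε₃ <;>
        simp [Gain, step, up, down, thr, base, Head] <;> omega
    · rintro d (rfl | ⟨k, h, l, rfl, rfl⟩) <;> cases ε₁ <;> cases ε₂ <;> cases ε₃ <;>
        simp [Gain, step, up, down, thr, base, Head, hn4, hn3] <;> grind [thr]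
    · rintro d ⟨k, h, l, rfl, hh⟩
      cases ε₁ <;> cases ε₂ <;> cases ε₃ <;>
        simp [Gain, step, up, down, thr, Head] at hh ⊢ <;> omega
    · rintro d ⟨k, h, l, rfl, hh⟩
      cases ε₁ <;> cases ε₂ <;> cases ε₃ <;>
        simp [Gain, down, thr] at hh ⊢ <;> grind [thr]
  obtain ⟨v1, i1, p1⟩ := iterate_step hn2 hT h1 i valid_base h5
  obtain ⟨v2, i2, p2⟩ := iterate_step hn2 hT h3 j (v1.step hn2 (g := true) (ε := ε₂)) (h2 _ i1).2
  refine ⟨T, hT, ?_⟩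
  rw [Function.iterate_succ_apply, (h4 _ i2).1.pot_eq hn2 hT v2, p2,
    (h2 _ i1).1.pot_eq hn2 hT v1, p1, pot_base]
  ring


/-! ### The action of words on normal forms -/

section Run

variable {X : Type*} [DecidableEq X] {x y : X} {u v : Word X} {s : X × Bool}

/-- The action of a word over `x, y` on normal forms. -/
def run (n : ℕ) (x : X) (u : Word X) (d : Raw) : Raw :=
  u.foldr (fun s => step n (decide (s.1 = x)) s.2) d

@[simp] theorem run_nil : run n x [] d = d := rfl

@[simp] theorem run_cons : run n x (s :: u) d = step n (decide (s.1 = x)) s.2 (run n x u d) := rfl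

theorem run_append : run n x (u ++ v) d = run n x u (run n x v d) := by
  simp [run]

theorem run_replicate (j : ℕ) :
    run n x (List.replicate j s) d = (step n (decide (s.1 = x)) s.2)^[j] d := by
  induction j with
  | zero => rfl
  | succ j ih => rw [List.replicate_succ, run_cons, ih, Function.iterate_succ_apply']

theorem Valid.run (hn : 2 ≤ n) (hd : Valid n d) : Valid n (run n x u d) := by
  induction u with
  | nil => exact hd
  | cons s u ih => exact ih.step hn

theorem valid_run_base (hn : 2 ≤ n) : Valid n (run n x u base) := valid_base.run hn

theorem pot_run (hn : 2 ≤ n) (u : Word X) {t : ℤ} (h0 : 0 ≤ t) (ht : t ≤ n) :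
    ∃ i : ℕ, pot n t (run n x u base) + 2 * i = u.length := by
  induction u with
  | nil => exact ⟨0, by simp⟩
  | cons s u ih =>
    obtain ⟨i, hi⟩ := ih
    rcases pot_step (g := decide (s.1 = x)) (ε := s.2) hn (valid_run_base (x := x) (u := u) hn) h0 ht
      with h | h
    · exact ⟨i, by rw [run_cons, h, List.length_cons]; push_cast; omega⟩
    · exact ⟨i + 1, by rw [run_cons, h, List.length_cons]; push_cast; omega⟩

theorem exists_run (hn : 2 ≤ n) (hxy : x ≠ y) (N : ℕ) : ∀ {d : Raw}, Valid n d →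
    (∀ t : ℤ, 0 ≤ t → t ≤ n → pot n t d ≤ N) →
    ∃ u, OnPair x y u ∧ u.length ≤ N ∧ run n x u base = d := by
  induction N with
  | zero =>
    intro d hd h
    exact ⟨[], by simp, by simp, (eq_base_of_pot hn hd h).symm⟩
  | succ N ih =>
    intro d hd h
    have key : ∀ g ε, (∀ t : ℤ, 0 ≤ t → t ≤ n → pot n t (step n g ε d) ≤ N) →
        ∃ u, OnPair x y u ∧ u.length ≤ N + 1 ∧ run n x u base = d := by
      intro g ε h'
      obtain ⟨u, hu, hl, hr⟩ := ih (hd.step hn) h'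
      refine ⟨(if g then x else y, !ε) :: u, ?_, by simpa using hl, ?_⟩
      · rw [onPair_cons]
        refine ⟨?_, hu⟩
        cases g <;> simp
      · have : decide ((if g then x else y) = x) = g := by cases g <;> simp [hxy.symm]
        rw [run_cons, hr, this]
        exact step_not_step hn hd
    rcases exists_descent hn hd (by exact_mod_cast h) with h' | ⟨g, h' | h'⟩
    · obtain ⟨u, hu, hl, hr⟩ := ih hd h'
      exact ⟨u, hu, by omega, hr⟩
    · exact key g true h'
    · exact key g false h'

variable {E : X → X → Word X → Word X → Prop}

/-- Equality of words over `x, y` is detected by the action on normal forms. -/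
def Detects (E : X → X → Word X → Word X → Prop) (n : ℕ) (x y : X) : Prop :=
  ∀ u v, OnPair x y u → OnPair x y v → (E x y u v ↔ run n x u base = run n x v base)

theorem pairGeod_iff (hn : 2 ≤ n) (hxy : x ≠ y) (hE : Detects E n x y) (hu : OnPair x y u) :
    PairGeod E x y u ↔ ∃ t : ℤ, 0 ≤ t ∧ t ≤ n ∧ pot n t (run n x u base) = u.length := by
  constructor
  · intro hg
    by_contra! hne
    have hlt : ∀ t : ℤ, 0 ≤ t → t ≤ n → pot n t (run n x u base) + 1 ≤ u.length := by
      intro t h0 ht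
      obtain ⟨i, hi⟩ := pot_run (x := x) hn u h0 ht
      have := hne t h0 ht
      omega
    obtain ⟨N, hN⟩ : ∃ N, u.length = N + 1 := by
      refine ⟨u.length - 1, ?_⟩
      rcases u with _ | ⟨s, u⟩
      · simpa using hlt 0 le_rfl (by omega)
      · simp
    obtain ⟨v, hv, hl, hr⟩ := exists_run (N := N) hn hxy (valid_run_base (x := x) (u := u) hn)
      fun t h0 ht => by
        have := hlt t h0 ht
        omega
    have := hg v hv ((hE u v hu hv).2 hr.symm)
    omega
  · rintro ⟨t, h0, ht, he⟩ v hv h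
    rw [(hE u v hu hv).1 h] at he
    obtain ⟨i, hi⟩ := pot_run (x := x) hn v h0 ht
    omega

theorem exchange_of_detects (hn : 2 ≤ n) (hxy : x ≠ y) (hE : Detects E n x y)
    (hsu : OnPair x y (s :: u)) (hg : PairGeod E x y u) (hg' : ¬ PairGeod E x y (s :: u)) :
    ∃ q, OnPair x y q ∧ E x y u (letterInv s :: q) ∧ q.length + 1 = u.length := by
  obtain ⟨hs, hu⟩ := onPair_cons.1 hsu
  rw [pairGeod_iff hn hxy hE hsu] at hg'
  push Not at hg'
  have hle : ∀ t : ℤ, 0 ≤ t → t ≤ n → pot n t (run n x (s :: u) base) ≤ (u.length - 1 : ℕ) := by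
    intro t h0 ht
    have h1 := hg' t h0 ht
    obtain ⟨i, hi⟩ := pot_run (x := x) hn (s :: u) h0 ht
    rw [List.length_cons] at h1 hi
    push_cast at h1 hi
    omega
  obtain ⟨q, hq, hl, hr⟩ := exists_run hn hxy _ (valid_run_base (x := x) hn) hle
  have hsq : OnPair x y (letterInv s :: q) := by
    rw [onPair_cons]
    exact ⟨hs, hq⟩
  have he : E x y u (letterInv s :: q) := by
    rw [hE _ _ hu hsq, run_cons, hr, run_cons]
    exact (step_not_step hn (valid_run_base hn)).symm
  have h1 := hg _ hsq he
  rw [List.length_cons] at h1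
  refine ⟨q, hq, he, ?_⟩
  rcases u with _ | ⟨r, u⟩
  · obtain rfl : q = [] := List.eq_nil_of_length_eq_zero (by simpa using hl)
    have h2 := (hE _ _ hu hsq).1 he
    have h3 := pot_step (g := decide ((letterInv s).1 = x)) (ε := (letterInv s).2) hn
      valid_base (t := 0) le_rfl (by omega)
    rw [run_cons, run_nil] at h2
    rw [← h2] at h3
    simp at h3
  · simp at hl h1 ⊢
    omega

theorem not_inv_of_detects (hn : 2 ≤ n) (hxy : x ≠ y) (hE : Detects E n x y)
    (hsu : OnPair x y (s :: u)) (hv : OnPair x y v) (hg : PairGeod E x y (s :: u))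
    (he : E x y (s :: u) (letterInv s :: v)) (hl : u.length = v.length) : False := by
  have hsv : OnPair x y (letterInv s :: v) := by
    rw [onPair_cons] at hsu ⊢
    exact ⟨hsu.1, hv⟩
  obtain ⟨t, h0, ht, h⟩ := (pairGeod_iff hn hxy hE hsu).1 hg
  have he' := (hE _ _ hsu hsv).1 he
  obtain ⟨i, hi⟩ := pot_run (x := x) hn u h0 ht
  obtain ⟨j, hj⟩ := pot_run (x := x) hn v h0 ht
  have h1 : step n (decide (s.1 = x)) (!s.2) (run n x (s :: u) base) = run n x u base :=
    step_not_step hn (valid_run_base hn)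
  have h2 : step n (decide (s.1 = x)) s.2 (run n x (s :: u) base) = run n x v base := by
    rw [he']
    have := step_not_step (g := decide (s.1 = x)) (ε := !s.2) hn (valid_run_base (x := x) (u := v) hn)
    rwa [Bool.not_not] at this
  rw [List.length_cons] at h
  push_cast at h
  have h3 := pot_step_not (g := decide (s.1 = x)) (ε := s.2) hn
    (valid_run_base (x := x) (u := s :: u) hn) h0 ht (by rw [h2, h]; omega)
  rw [h1] at h3
  omega

theorem two_blocks_of_detects (hn : 3 ≤ n) (hxy : x ≠ y) (hE : Detects E n x y) (i j : ℕ)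
    {ε₁ ε₂ ε₃ : Bool} (hu : OnPair x y u)
    (he : E x y (List.replicate (j + 1) (x, ε₂) ++ List.replicate i (y, ε₁)) ((y, ε₃) :: u))
    (hl : j + 1 + i = u.length + 1) : False := by
  have hn2 : 2 ≤ n := by omega
  have h1 : OnPair x y (List.replicate (j + 1) (x, ε₂) ++ List.replicate i (y, ε₁)) := by
    rw [onPair_append]
    constructor <;> intro p hp <;> rw [List.eq_of_mem_replicate hp] <;> simp
  have h2 := (hE _ _ h1 (by simp [hu])).1 he
  obtain ⟨T, hT, h⟩ := pot_three_blocks hn ε₁ ε₂ (!ε₃) i j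
  have hy : decide (y = x) = false := by simp [hxy.symm]
  rw [run_append, run_replicate, run_replicate, run_cons] at h2
  simp only [hy, decide_true] at h2
  rw [h2, step_not_step hn2 (valid_run_base hn2)] at h
  obtain ⟨k, hk⟩ := pot_run (x := x) hn2 u (t := T) (by omega) (by omega)
  omega

end Run

/-! ### Comparison with dihedral Artin groups -/

section Value

variable {P : Type*} [Group P] {p : Bool → P}

/-- The value of an alternating positive word of length `j` starting with `g`. -/
def altVal (p : Bool → P) : ℕ → Bool → P
  | 0, _ => 1
  | j + 1, g => p g * altVal p j (!g)

theorem altVal_succ' (p : Bool → P) : ∀ (j : ℕ) (g : Bool),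
    altVal p (j + 1) g = altVal p j g * p (shift j g)
  | 0, g => by simp [altVal, shift]
  | j + 1, g => by
    rw [altVal, altVal_succ' p j, shift_succ, ← mul_assoc]
    rfl

/-- The value of a list of alternating words, the first starting with `b`. -/
def listVal (p : Bool → P) : Bool → List ℕ → P
  | _, [] => 1
  | b, h :: l => altVal p h b * listVal p (shift (h + 1) b) l

/-- The group element represented by a normal form. -/
def val (n : ℕ) (p : Bool → P) (d : Raw) : P := listVal p d.2.2 d.2.1 * altVal p n true ^ d.1

theorem listVal_canon (b : Bool) (l : List ℕ) : listVal p (canon l b) l = listVal p b l := by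
  cases l <;> rfl

theorem altVal_eq (hp : altVal p n true = altVal p n false) (g : Bool) :
    altVal p n g = altVal p n true := by
  cases g
  exacts [hp.symm, rfl]

theorem garside_mul_gen (hp : altVal p n true = altVal p n false) (g : Bool) :
    altVal p n true * p g = p (shift n g) * altVal p n true := by
  have h1 := altVal_succ' p n (shift n g)
  rw [shift_shift, altVal, altVal_eq hp (!_), altVal_eq hp (shift n g)] at h1
  exact h1.symm

theorem garside_mul_altVal (hp : altVal p n true = altVal p n false) : ∀ (j : ℕ) (g : Bool),
    altVal p n true * altVal p j g = altVal p j (shift n g) * altVal p n true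
  | 0, g => by simp [altVal]
  | j + 1, g => by
    rw [altVal, ← mul_assoc, garside_mul_gen hp, mul_assoc, garside_mul_altVal hp j, ← mul_assoc,
      shift_not]
    rfl

theorem shift_comm (i j : ℕ) (b : Bool) : shift i (shift j b) = shift j (shift i b) := by
  simp only [shift]
  split_ifs <;> rfl

theorem garside_mul_listVal (hp : altVal p n true = altVal p n false) : ∀ (l : List ℕ) (b : Bool),
    altVal p n true * listVal p b l = listVal p (shift n b) l * altVal p n true
  | [], b => by simp [listVal]
  | h :: l, b => by
    rw [listVal, ← mul_assoc, garside_mul_altVal hp, mul_assoc, garside_mul_listVal hp l,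
      ← mul_assoc, shift_comm]
    rfl

theorem val_up (hn : 2 ≤ n) (hp : altVal p n true = altVal p n false) (hd : Valid n d) :
    val n p (up n g d) = p g * val n p d := by
  obtain ⟨k, l, b⟩ := d
  rcases l with _ | ⟨h, l⟩
  · simp [val, up, listVal, altVal]
  · have h1 := hd.1 h (by simp)
    simp only [up]
    split_ifs with h2 h3
    · subst h2
      simp [val, listVal, altVal, shift, mul_assoc]
    · obtain rfl : b = !g := by cases b <;> cases g <;> simp_all
      simp [val, listVal, altVal, shift_succ', mul_assoc]
    · obtain rfl : b = !g := by cases b <;> cases g <;> simp_all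
      obtain rfl : n = h + 1 := by omega
      simp only [val, listVal, listVal_canon]
      rw [← mul_assoc, ← mul_assoc]
      change _ = altVal p (h + 1) g * _ * _
      rw [altVal_eq hp g, garside_mul_listVal hp, shift_shift, mul_assoc, add_comm k 1, zpow_one_add]

theorem val_step (hn : 2 ≤ n) (hp : altVal p n true = altVal p n false) (hd : Valid n d)
    (ε : Bool) : val n p (step n g ε d) = (if ε then p g else (p g)⁻¹) * val n p d := by
  cases ε
  · have := val_up (g := g) hn hp (hd.down (g := g) hn)
    rw [up_down hn hd] at this
    simp [step, this]
  · simpa [step] using val_up hn hp hd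

theorem val_run {X : Type*} [DecidableEq X] {x y : X} (hxy : x ≠ y) (hn : 2 ≤ n) (f : X → P)
    (hp : altVal p n true = altVal p n false) (hx : f x = p true) (hy : f y = p false) (hd : Valid n d) :
    ∀ {u : Word X}, OnPair x y u → val n p (run n x u d) = evalWord f u * val n p d
  | [], _ => by simp
  | s :: u, hu => by
    obtain ⟨hs, hu⟩ := onPair_cons.1 hu
    rw [run_cons, val_step hn hp (hd.run hn), val_run hxy hn f hp hx hy hd hu, evalWord_cons f s u,
      mul_assoc]
    obtain ⟨z, ε⟩ := s
    congr 1
    rcases hs with rfl | rfl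
    · simp [evalWord, hx]
    · simp [evalWord, hy, hxy.symm]

theorem evalWord_altWord {X : Type*} (f : X → P) (x y : X) (hx : f x = p true)
    (hy : f y = p false) : ∀ j, evalWord f (altWord j x y) = altVal p j true ∧
      evalWord f (altWord j y x) = altVal p j false
  | 0 => by simp [altWord, altVal]
  | j + 1 => by
    obtain ⟨h1, h2⟩ := evalWord_altWord f x y hx hy j
    rw [altWord, altWord, evalWord_cons, h2, evalWord_cons f _ (altWord j x y), h1]
    simp [evalWord, altVal, hx, hy]

/-- The permutation of normal forms induced by a generator. -/
def upPerm (hn : 2 ≤ n) (g : Bool) : Equiv.Perm {d : Raw // Valid n d} where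
  toFun d := ⟨up n g d.1, d.2.up hn⟩
  invFun d := ⟨down n g d.1, d.2.down hn⟩
  left_inv d := Subtype.ext (down_up hn d.2)
  right_inv d := Subtype.ext (up_down hn d.2)

theorem altVal_upPerm (hn : 2 ≤ n) (d : {d : Raw // Valid n d}) : ∀ (j : ℕ) (g : Bool),
    (altVal (upPerm hn) j g d).1 = altUp n j g d.1
  | 0, _ => rfl
  | j + 1, g => by
    rw [altVal, altUp, Equiv.Perm.mul_apply, ← altVal_upPerm hn d j]
    rfl

theorem altVal_upPerm_full (hn : 2 ≤ n) :
    altVal (upPerm hn) n true = altVal (upPerm hn) n false := by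
  ext1 d
  apply Subtype.ext
  rw [altVal_upPerm, altVal_upPerm]
  obtain ⟨⟨k, l, b⟩, hd⟩ := d
  rw [altUp_full hn hd, altUp_full hn hd]

theorem evalWord_upPerm {X : Type*} [DecidableEq X] {x y : X} (hxy : x ≠ y) (hn : 2 ≤ n)
    (f : X → Equiv.Perm {d : Raw // Valid n d}) (hx : f x = upPerm hn true)
    (hy : f y = upPerm hn false) (d : {d : Raw // Valid n d}) :
    ∀ {u : Word X}, OnPair x y u → (evalWord f u d).1 = run n x u d.1
  | [], _ => rfl
  | s :: u, hu => by
    obtain ⟨hs, hu⟩ := onPair_cons.1 hu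
    rw [evalWord_cons f s u, Equiv.Perm.mul_apply, run_cons,
      ← evalWord_upPerm hxy hn f hx hy d hu]
    obtain ⟨z, ε⟩ := s
    rcases hs with rfl | rfl
    · cases ε <;> simp [evalWord, hx] <;> rfl
    · cases ε <;> simp [evalWord, hy, hxy.symm] <;> rfl

end Value

end DihedralModel

/-! ### Dihedral Artin groups form a dihedral system -/

section PairGroup

variable {X : Type*} {m : X → X → ℕ∞} {x y : X} {u v α β : Word X} {s : X × Bool}

open Classical in
/-- The labelling keeping only the edge between `x` and `y`. -/
noncomputable def pairLabel (m : X → X → ℕ∞) (x y a b : X) : ℕ∞ :=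
  if (a = x ∧ b = y) ∨ (a = y ∧ b = x) then m x y else ⊤

/-- Equality of words modulo the relation between `x` and `y` only. -/
def PairRel (m : X → X → ℕ∞) (x y : X) (u v : Word X) : Prop :=
  evalWord (artinGen (pairLabel m x y)) u = evalWord (artinGen (pairLabel m x y)) v

theorem pairLabel_swap (hm : ∀ x y, m x y = m y x) : pairLabel m x y = pairLabel m y x := by
  funext a b
  simp only [pairLabel, hm x y]
  congr 1
  exact propext or_comm

theorem pairLabel_self : pairLabel m x y x y = m x y := by simp [pairLabel]

theorem exists_pairHom {G : Type*} [Group G] (f : X → G)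
    (h : ∀ k : ℕ, m x y = k → evalWord f (altWord k x y) = evalWord f (altWord k y x)) :
    ∃ φ : ArtinGroup (pairLabel m x y) →* G, φ ∘ artinGen (pairLabel m x y) = f := by
  refine exists_artinGroup_hom _ f fun a b k _ hk => ?_
  simp only [pairLabel] at hk
  split_ifs at hk with h1
  · rcases h1 with ⟨rfl, rfl⟩ | ⟨rfl, rfl⟩
    exacts [h k hk, (h k hk).symm]
  · simp at hk

theorem PairRel.evalWord_eq {G : Type*} [Group G] (f : X → G)
    (h : ∀ k : ℕ, m x y = k → evalWord f (altWord k x y) = evalWord f (altWord k y x))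
    (huv : PairRel m x y u v) : evalWord f u = evalWord f v := by
  obtain ⟨φ, hφ⟩ := exists_pairHom f h
  rw [← hφ, ← map_evalWord, ← map_evalWord, huv]

open DihedralModel in
theorem detects_pairRel [DecidableEq X] {n : ℕ} (hn : 2 ≤ n) (hxy : x ≠ y) (h : m x y = n) :
    Detects (PairRel m) n x y := by
  intro u v hu hv
  constructor
  · intro huv
    let f : X → Equiv.Perm {d : Raw // Valid n d} :=
      fun z => if z = x then upPerm hn true else upPerm hn false
    have hx : f x = upPerm hn true := by simp [f]
    have hy : f y = upPerm hn false := by simp [f, hxy.symm]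
    have he := huv.evalWord_eq f fun k hk => by
      obtain rfl : n = k := by
        rw [h] at hk
        exact_mod_cast hk
      obtain ⟨h1, h2⟩ := evalWord_altWord (p := upPerm hn) f x y hx hy n
      rw [h1, h2, altVal_upPerm_full]
    rw [← evalWord_upPerm hxy hn f hx hy ⟨base, valid_base⟩ hu,
      ← evalWord_upPerm hxy hn f hx hy ⟨base, valid_base⟩ hv, he]
  · intro huv
    let f := artinGen (pairLabel m x y)
    let p : Bool → ArtinGroup (pairLabel m x y) := fun b => if b then f x else f y
    have hx : f x = p true := rfl
    have hy : f y = p false := rfl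
    obtain ⟨h1, h2⟩ := evalWord_altWord (p := p) f x y hx hy n
    have hp : altVal p n true = altVal p n false := by
      rw [← h1, ← h2]
      exact evalWord_artinGen_altWord _ hxy (pairLabel_self.trans h)
    have h3 := val_run hxy hn f hp hx hy valid_base hu
    rw [huv, val_run hxy hn f hp hx hy valid_base hv] at h3
    exact (mul_right_cancel h3).symm

theorem evalWord_freeGroup_of (u : Word X) : evalWord FreeGroup.of u = FreeGroup.mk u := by
  have := FreeGroup.lift_of_apply (FreeGroup.mk u)
  rw [← this, FreeGroup.lift_mk]
  simp only [evalWord, Bool.cond_eq_ite]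

open Classical in
theorem pairRel_iff_reduce (h : m x y = ⊤) :
    PairRel m x y u v ↔ FreeGroup.reduce u = FreeGroup.reduce v := by
  constructor
  · intro huv
    have := huv.evalWord_eq FreeGroup.of fun k hk => by simp [h] at hk
    rw [evalWord_freeGroup_of, evalWord_freeGroup_of] at this
    exact FreeGroup.reduce.sound this
  · intro huv
    have h1 := congrArg (FreeGroup.lift (artinGen (pairLabel m x y))) (FreeGroup.reduce.exact huv)
    rwa [← evalWord_freeGroup_of, ← evalWord_freeGroup_of, map_evalWord, map_evalWord,
      show ⇑(FreeGroup.lift (artinGen (pairLabel m x y))) ∘ FreeGroup.of =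
        artinGen (pairLabel m x y) by ext; simp] at h1

open Classical in
theorem pairGeod_iff_reduce (h : m x y = ⊤) (hu : OnPair x y u) :
    PairGeod (PairRel m) x y u ↔ FreeGroup.reduce u = u := by
  have hsub : ∀ v : Word X, (FreeGroup.reduce v).Sublist v := fun v => FreeGroup.reduce.red.sublist
  constructor
  · intro hg
    refine (hsub u).eq_of_length_le (hg _ (fun p hp => hu p ((hsub u).subset hp)) ?_)
    rw [pairRel_iff_reduce h, FreeGroup.reduce.idem]
  · intro hr v hv huv
    rw [pairRel_iff_reduce h] at huv
    rw [← hr, huv]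
    exact (hsub v).length_le

theorem eq_of_pairRel (h : m x y = ⊤) (hu : OnPair x y u) (hg : PairGeod (PairRel m) x y u)
    (huv : PairRel m x y u v) (hl : v.length ≤ u.length) : u = v := by
  classical
  rw [pairGeod_iff_reduce h hu] at hg
  rw [pairRel_iff_reduce h, hg] at huv
  rw [huv] at hl ⊢
  exact FreeGroup.reduce.red.sublist.eq_of_length_le hl

theorem exchange_of_top (h : m x y = ⊤) (hsu : OnPair x y (s :: u))
    (hg : PairGeod (PairRel m) x y u) (hg' : ¬ PairGeod (PairRel m) x y (s :: u)) :
    ∃ q, OnPair x y q ∧ PairRel m x y u (letterInv s :: q) ∧ q.length + 1 = u.length := by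
  classical
  obtain ⟨hs, hu⟩ := onPair_cons.1 hsu
  rw [pairGeod_iff_reduce h hu] at hg
  rw [pairGeod_iff_reduce h hsu, FreeGroup.reduce.cons, hg] at hg'
  rcases u with _ | ⟨t, u⟩
  · simp at hg'
  · obtain ⟨-, hu⟩ := onPair_cons.1 hu
    refine ⟨u, hu, ?_, by simp⟩
    have : t = letterInv s := by
      by_contra hne
      refine hg' (if_neg ?_)
      rintro ⟨h1, h2⟩
      exact hne (Prod.ext h1.symm (by simp [letterInv, h2]))
    rw [this]
    rfl

theorem eq_replicate_of_no_cancel {z : X} : ∀ {α : Word X}, OnPair z z α →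
    (∀ γ s δ, α ≠ γ ++ letterInv s :: s :: δ) → ∃ ε, α = List.replicate α.length (z, ε)
  | [], _, _ => ⟨true, rfl⟩
  | [s], hα, _ => ⟨s.2, by
    have : s.1 = z := by simpa using hα
    rw [← this]
    rfl⟩
  | s :: t :: α, hα, h => by
    obtain ⟨ε, hε⟩ := eq_replicate_of_no_cancel (α := t :: α) (onPair_cons.1 hα).2
      fun γ r δ he => h (s :: γ) r δ (by rw [he]; rfl)
    refine ⟨ε, ?_⟩
    have hs : s.1 = z := by simpa using (onPair_cons.1 hα).1
    have ht : t = (z, ε) := by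
      rw [List.length_cons, List.replicate_succ] at hε
      exact (List.cons.inj hε).1
    have hst : s = t := by
      rcases eq_or_eq_letterInv (s := s) (t := t) (by rw [hs, ht]) with h1 | h1
      · exact h1
      · exact (h [] t α (by rw [h1]; simp)).elim
    rw [List.length_cons, List.replicate_succ, ← hε, hst, ht]

theorem PairGeod.no_cancel {γ δ : Word X} (hu : OnPair x y (γ ++ letterInv s :: s :: δ)) :
    ¬ PairGeod (PairRel m) x y (γ ++ letterInv s :: s :: δ) := by
  intro hg
  have h1 : OnPair x y (γ ++ δ) := by
    simp only [onPair_append, onPair_cons] at hu ⊢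
    exact ⟨hu.1, hu.2.2.2⟩
  have := hg (γ ++ δ) h1 (by
    unfold PairRel
    rw [evalWord_append, evalWord_append, evalWord_cons _ (letterInv s), evalWord_cons _ s,
      evalWord_letterInv, inv_mul_cancel_left])
  simp at this

theorem two_blocks_pairRel (hlarge : 3 ≤ m x y) (hxy : x ≠ y) (hα : OnPair x x α)
    (hβ : OnPair y y β) (hα0 : α ≠ []) (hg : PairGeod (PairRel m) x y (α ++ β)) (hs : s.1 = y)
    (hu : OnPair x y u) (he : PairRel m x y (α ++ β) (s :: u))
    (hl : α.length + β.length = u.length + 1) : False := by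
  classical
  have hαβ : OnPair x y (α ++ β) := by simp [hα.left, hβ.right]
  rcases hm : m x y with _ | n
  · have := eq_of_pairRel hm hαβ hg he (by simp [hl])
    rcases α with _ | ⟨t, α⟩
    · exact hα0 rfl
    · have ht : t.1 = x := by simpa using (onPair_cons.1 hα).1
      rw [List.cons_append, List.cons.injEq] at this
      rw [← ht, ← hs, this.1] at hxy
      exact hxy rfl
  · have hm' : m x y = (n : ℕ∞) := hm
    have hn : 3 ≤ n := by
      rw [hm'] at hlarge
      exact_mod_cast hlarge
    obtain ⟨ε₂, h2⟩ := eq_replicate_of_no_cancel hα fun γ r δ h => by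
      rw [h, List.append_assoc] at hg hαβ
      exact PairGeod.no_cancel hαβ hg
    obtain ⟨ε₁, h1⟩ := eq_replicate_of_no_cancel hβ fun γ r δ h => by
      rw [h, ← List.append_assoc] at hg hαβ
      exact PairGeod.no_cancel hαβ hg
    obtain ⟨j, hj⟩ : ∃ j, α.length = j + 1 := ⟨α.length - 1, by
      have := List.length_pos_of_ne_nil hα0
      omega⟩
    rw [h1, h2, hj, show s = (y, s.2) from Prod.ext hs rfl] at he
    exact DihedralModel.two_blocks_of_detects hn hxy (detects_pairRel (by omega) hxy hm') _ j hu he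
      (by omega)

theorem dihedralSystem_pairRel (hsymm : ∀ x y, m x y = m y x)
    (hlarge : ∀ x y, x ≠ y → 3 ≤ m x y) : DihedralSystem (PairRel m) where
  refl _ _ _ := rfl
  symm h := h.symm
  trans h h' := h.trans h'
  swap {x y u v} h := by
    unfold PairRel at h ⊢
    rwa [pairLabel_swap hsymm]
  append_right w h := by
    unfold PairRel at h ⊢
    rw [evalWord_append, evalWord_append, h]
  cons {x y u v} s h := by
    unfold PairRel at h ⊢
    rw [evalWord_cons _ s u, evalWord_cons _ s v, h]
  inv_cons_cons {x y u} s := by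
    unfold PairRel
    rw [evalWord_cons _ (letterInv s), evalWord_cons _ s, evalWord_letterInv, inv_mul_cancel_left]
  exchange {x y u s} hxy hsu hg hg' := by
    classical
    rcases hm : m x y with _ | n
    · exact exchange_of_top hm hsu hg hg'
    · have hm' : m x y = (n : ℕ∞) := hm
      have hn : 3 ≤ n := by exact_mod_cast hm' ▸ hlarge x y hxy
      exact DihedralModel.exchange_of_detects (by omega) hxy (detects_pairRel (by omega) hxy hm')
        hsu hg hg'
  not_inv {x y u v s} hxy hsu hv hg he hl := by
    classical
    rcases hm : m x y with _ | n
    · have := eq_of_pairRel hm hsu hg he (by simp [hl])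
      have := congrArg Prod.snd (List.cons.inj this).1
      simp [letterInv] at this
    · have hm' : m x y = (n : ℕ∞) := hm
      have hn : 3 ≤ n := by exact_mod_cast hm' ▸ hlarge x y hxy
      exact DihedralModel.not_inv_of_detects (by omega) hxy (detects_pairRel (by omega) hxy hm')
        hsu hv hg he hl
  two_blocks {x y α β u s} hxy hα hβ hα0 hg hs hu he hl :=
    two_blocks_pairRel (hlarge x y hxy) hxy hα hβ hα0 hg hs hu he hl

end PairGroup

/-- In an Artin group of large type, for pairwise distinct generators `a, b, c`
and any signs `ε₁, ε₂, ε₃`, the pair `(a^{ε₁} b^{ε₂}, c^{ε₃})` is a blocking pair. -/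
theorem largeType_blockingPair {X : Type*} [Fintype X] (m : X → X → ℕ∞)
    (hsymm : ∀ x y : X, m x y = m y x)
    (hlarge : ∀ x y : X, x ≠ y → 3 ≤ m x y)
    (a b c : X) (hab : a ≠ b) (hbc : b ≠ c) (hac : a ≠ c)
    (ε₁ ε₂ ε₃ : Bool) :
    BlockingPair (artinGen m) [(a, ε₁), (b, ε₂)] (c, ε₃) := by
  exact (dihedralSystem_pairRel hsymm hlarge).blockingPair m
    (fun _ _ _ hxy hk => evalWord_artinGen_altWord _ hxy (pairLabel_self.trans hk))
    (fun x y _ _ huv => huv.evalWord_eq (artinGen m) fun k hk => by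
      by_cases hxy : x = y
      · rw [hxy]
      · exact evalWord_artinGen_altWord m hxy hk)
    (a, ε₁) (b, ε₂) (c, ε₃) hab hbc hac
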